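/- arXiv:2212.00315 — 4 statements merged into one kernel-verified Lean document; each statement's English description precedes it below -/
import Mathlib

section
/- Let (T(t))_{t≥0} be a bounded C₀-semigroup on a complex Banach space X and let B be a bounded linear operator on X that is sectorial (i.e., every real λ > 0 satisfies that λ + B is invertible in L(X) and there is K > 0 with ‖λ(λ + B)⁻¹‖ ≤ K for all λ > 0) and commutes with T(t) for every t ≥ 0 (T(t)B = BT(t)). Then for every fixed real α > 0 and integer n ≥ 1 the following are equivalent: (i) there exist M₁, t₁ > 0 such that ‖T(t)B‖ ≤ M₁ t^{-1/α} for all t ≥ t₁; (ii) there exist M₂, t₂ > 0 such that ‖T(t)Bⁿ‖ ≤ M₂ t^{-n/α} for all t ≥ t₂. -/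
theorem norm_mul_pow_le_mul_pow {A : Type*} [NormedRing A] (a b : A) (m : ℕ) :
    ‖a * b ^ m‖ ≤ ‖a‖ * ‖b‖ ^ m := by
  induction m with
  | zero => simp
  | succ m ih =>
    calc ‖a * b ^ (m + 1)‖ = ‖(a * b ^ m) * b‖ := by rw [pow_succ, mul_assoc]
      _ ≤ ‖a * b ^ m‖ * ‖b‖ := norm_mul_le _ _
      _ ≤ (‖a‖ * ‖b‖ ^ m) * ‖b‖ := by gcongr
      _ = ‖a‖ * ‖b‖ ^ (m + 1) := by ring

/-- Iterated resolvent expansion of `b` when `v` is the inverse of `l + b`. -/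
theorem eq_smul_sum_add_pow_mul_pow {A : Type*} [Ring A] [Algebra ℂ A] {b v : A} {l : ℂ}
    (hr : (l • (1 : A) + b) * v = 1) (hl : v * (l • (1 : A) + b) = 1) (m : ℕ) :
    b = l • ∑ k ∈ Finset.range m, (b * v) ^ (k + 1) + b ^ (m + 1) * v ^ m := by
  have hcomm : Commute b v := by
    rw [add_mul, smul_mul_assoc, one_mul] at hr
    rw [mul_add, mul_smul_comm, mul_one] at hl
    exact add_left_cancel (hr.trans hl.symm)
  induction m with
  | zero => simp
  | succ m ih =>
    have hstep : b ^ (m + 1) * v ^ m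
        = l • (b * v) ^ (m + 1) + b ^ (m + 1 + 1) * v ^ (m + 1) := by
      calc b ^ (m + 1) * v ^ m = b ^ (m + 1) * (((l • (1 : A) + b) * v) * v ^ m) := by
            rw [hr, one_mul]
        _ = b ^ (m + 1) * ((l • (1 : A) + b) * v ^ (m + 1)) := by rw [mul_assoc, ← pow_succ']
        _ = _ := by
            rw [hcomm.mul_pow, add_mul, smul_mul_assoc, one_mul, mul_add, mul_smul_comm,
              ← mul_assoc, ← pow_succ]
    rw [Finset.sum_range_succ, smul_add, add_assoc, ← hstep]
    exact ih

/-- A moment inequality for sectorial elements, in additive form. -/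
theorem norm_mul_le_of_sectorial {A : Type*} [NormedRing A] [NormedAlgebra ℂ A] {b v : A}
    {l K : ℝ} (hl0 : 0 < l) (hr : ((l : ℂ) • (1 : A) + b) * v = 1)
    (hl : v * ((l : ℂ) • (1 : A) + b) = 1) (hK : ‖(l : ℂ) • v‖ ≤ K) (s : A) (m : ℕ) :
    ‖s * b‖ ≤ l * (‖s‖ * ∑ k ∈ Finset.range m, (‖(1 : A)‖ + K) ^ (k + 1))
      + ‖s * b ^ (m + 1)‖ * (K / l) ^ m := by
  have hv : ‖v‖ ≤ K / l := by
    rw [norm_smul, Complex.norm_real, Real.norm_of_nonneg hl0.le] at hK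
    rwa [le_div_iff₀' hl0]
  have hbv : ‖b * v‖ ≤ ‖(1 : A)‖ + K := by
    have h : b * v = 1 - (l : ℂ) • v := by
      rw [add_mul, smul_mul_assoc, one_mul] at hr
      exact eq_sub_of_add_eq' hr
    rw [h]
    exact (norm_sub_le _ _).trans (by gcongr)
  have hexp : s * b = (l : ℂ) • ∑ k ∈ Finset.range m, s * (b * v) ^ (k + 1)
      + s * b ^ (m + 1) * v ^ m := by
    conv_lhs => rw [eq_smul_sum_add_pow_mul_pow hr hl m]
    rw [mul_add, mul_smul_comm, Finset.mul_sum, mul_assoc]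
  rw [hexp]
  refine (norm_add_le _ _).trans (add_le_add ?_ ?_)
  · rw [norm_smul, Complex.norm_real, Real.norm_of_nonneg hl0.le, Finset.mul_sum]
    gcongr
    refine norm_sum_le_of_le _ fun k _ => (norm_mul_pow_le_mul_pow _ _ _).trans ?_
    gcongr
  · refine (norm_mul_pow_le_mul_pow _ _ _).trans ?_
    gcongr

theorem semigroup_nat_mul {A : Type*} [Monoid A] {T : ℝ → A} (hT0 : T 0 = 1)
    (hT : ∀ s t : ℝ, 0 ≤ s → 0 ≤ t → T (s + t) = T s * T t) {s : ℝ} (hs : 0 ≤ s) (n : ℕ) :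
    T (n * s) = T s ^ n := by
  induction n with
  | zero => simp [hT0]
  | succ n ih =>
    rw [Nat.cast_succ, add_mul, one_mul, hT _ _ (by positivity) hs, ih, pow_succ]

/-- For a bounded C₀-semigroup `T` on a complex Banach space `X` and a
bounded sectorial operator `B` commuting with the semigroup, polynomial decay of
`‖T(t)B‖` at rate `t^(-1/α)` is equivalent to decay of `‖T(t)Bⁿ‖` at rate `t^(-n/α)`. -/
theorem stmt_0
    {X : Type*} [NormedAddCommGroup X] [NormedSpace ℂ X] [CompleteSpace X]
    (T : ℝ → X →L[ℂ] X)
    (hT0 : T 0 = 1)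
    (hTsemi : ∀ s t : ℝ, 0 ≤ s → 0 ≤ t → T (s + t) = T s ∘L T t)
    (hTcont : ∀ x : X, ContinuousOn (fun t : ℝ => T t x) (Set.Ici 0))
    (hTbdd : ∃ c : ℝ, ∀ t : ℝ, 0 ≤ t → ‖T t‖ ≤ c)
    (B : X →L[ℂ] X)
    (Binv : ℝ → X →L[ℂ] X)
    (hBinv : ∀ l : ℝ, 0 < l →
      ((l : ℂ) • (1 : X →L[ℂ] X) + B) ∘L Binv l = 1 ∧
      (Binv l) ∘L ((l : ℂ) • (1 : X →L[ℂ] X) + B) = 1)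
    (hBsec : ∃ K > 0, ∀ l : ℝ, 0 < l → ‖(l : ℂ) • Binv l‖ ≤ K)
    (hcomm : ∀ t : ℝ, 0 ≤ t → (T t) ∘L B = B ∘L (T t))
    (α : ℝ) (hα : 0 < α) (n : ℕ) (hn : 1 ≤ n) :
    (∃ M₁ > 0, ∃ t₁ > 0, ∀ t : ℝ, t₁ ≤ t → ‖(T t) ∘L B‖ ≤ M₁ * t ^ (-(1 / α)))
      ↔ (∃ M₂ > 0, ∃ t₂ > 0, ∀ t : ℝ, t₂ ≤ t →
          ‖(T t) ∘L (B ^ n)‖ ≤ M₂ * t ^ (-((n : ℝ) / α))) := by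
  constructor
  · rintro ⟨M, hM, t₁, ht₁, h⟩
    have hn0 : (0 : ℝ) < n := by exact_mod_cast hn
    refine ⟨M ^ n * (n : ℝ) ^ ((n : ℝ) / α), by positivity, n * t₁, by positivity,
      fun t ht => ?_⟩
    have ht0 : 0 < t := lt_of_lt_of_le (by positivity) ht
    have hs0 : 0 ≤ t / n := by positivity
    have hTB : T t ∘L B ^ n = (T (t / n) ∘L B) ^ n := by
      have hpow := semigroup_nat_mul hT0 hTsemi hs0 n
      rw [mul_div_cancel₀ t hn0.ne'] at hpow
      rw [hpow]
      exact (Commute.mul_pow (hcomm _ hs0) n).symm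
    rw [hTB]
    calc ‖(T (t / n) ∘L B) ^ n‖ ≤ ‖T (t / n) ∘L B‖ ^ n := norm_pow_le' _ hn
      _ ≤ (M * (t / n) ^ (-(1 / α))) ^ n := by
        gcongr
        exact h _ ((le_div_iff₀' hn0).2 ht)
      _ = M ^ n * (n : ℝ) ^ ((n : ℝ) / α) * t ^ (-((n : ℝ) / α)) := by
        rw [mul_pow, ← Real.rpow_mul_natCast hs0,
          show -(1 / α) * (n : ℝ) = -((n : ℝ) / α) by ring,
          Real.div_rpow ht0.le hn0.le, Real.rpow_neg hn0.le, div_inv_eq_mul]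
        ring
  · rintro ⟨M, hM, t₂, ht₂, h⟩
    obtain ⟨c, hc⟩ := hTbdd
    obtain ⟨K, hK, hBK⟩ := hBsec
    obtain ⟨m, rfl⟩ : ∃ m, n = m + 1 := ⟨n - 1, by omega⟩
    have hc0 : 0 ≤ c := (norm_nonneg _).trans (hc 0 le_rfl)
    set S : ℝ := ∑ k ∈ Finset.range m, (‖(1 : X →L[ℂ] X)‖ + K) ^ (k + 1)
    have hS : 0 ≤ S := by positivity
    refine ⟨c * S + M * K ^ m, by positivity, t₂, ht₂, fun t ht => ?_⟩
    have ht0 : 0 < t := ht₂.trans_le ht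
    have hl : 0 < t ^ (-(1 / α)) := Real.rpow_pos_of_pos ht0 _
    have hpow : t ^ (-(((m + 1 : ℕ) : ℝ) / α)) = (t ^ (-(1 / α))) ^ (m + 1) := by
      rw [← Real.rpow_mul_natCast ht0.le]
      congr 1
      ring
    have hdecay := h t ht
    rw [hpow] at hdecay
    obtain ⟨hr, hl'⟩ := hBinv _ hl
    have hmoment := norm_mul_le_of_sectorial hl hr hl' (hBK _ hl) (T t) m
    have hTt := hc t ht0.le
    generalize t ^ (-(1 / α)) = l at *
    calc ‖T t ∘L B‖ ≤ l * (‖T t‖ * S) + ‖T t ∘L B ^ (m + 1)‖ * (K / l) ^ m := hmoment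
      _ ≤ l * (c * S) + M * l ^ (m + 1) * (K / l) ^ m := by gcongr
      _ = (c * S + M * K ^ m) * l := by
        rw [div_pow]
        field_simp
        ring
end

section
/- Let (T(t))_{t≥0} be a bounded C₀-semigroup on a complex Hilbert space X with generator A such that 0 lies in the resolvent set of A (so A⁻¹ is a bounded operator on X). Then for every fixed integer n ≥ 1 and real number p with 1 ≤ p < ∞ the following are equivalent: (i) there exist M, t₁ > 0 such that ‖T(t)A⁻¹‖ ≤ M t^{-1/(np)} for all t ≥ t₁; (ii) there exists K > 0 such that ‖A^{-n} R(λ,A)x‖ ≤ K ‖x‖ / (Re λ)^{1-1/p} for all λ with Re λ > 0 and all x ∈ X. (This is the integer-exponent case α = np of the paper's main polynomial-decay characterization, where the smoothing factor (−A)^{-α/p} has the same norm as A^{-n}.) -/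
open MeasureTheory Set Filter Topology FourierTransform
open scoped ContDiff

section Plancherel
variable {X : Type*} [NormedAddCommGroup X] [InnerProductSpace ℂ X] [CompleteSpace X]

theorem fourier_toLp_ae_eq {f : ℝ → X} (hf₁ : Integrable f) (hf₂ : MemLp f 2) :
    (𝓕 (hf₂.toLp f) : Lp X 2 (volume : Measure ℝ)) =ᵐ[volume] 𝓕 f := by
  have hcont : Continuous (𝓕 f) :=
    VectorFourier.fourierIntegral_continuous Real.continuous_fourierChar
      (by exact continuous_inner) hf₁
  refine ae_eq_of_integral_contDiff_smul_eq
    ((Lp.memLp _).locallyIntegrable (by norm_num)) hcont.locallyIntegrable ?_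
  intro g g_smooth g_cpt
  have hg₁ : HasCompactSupport (Complex.ofRealCLM ∘ g) := g_cpt.comp_left rfl
  have hg₂ : ContDiff ℝ ∞ (Complex.ofRealCLM ∘ g) := by fun_prop
  set φ := hg₁.toSchwartzMap hg₂ with hφ
  have h1 := congrArg (fun u => u φ) (Lp.fourier_toTemperedDistribution_eq (hf₂.toLp f))
  simp only [TemperedDistribution.fourier_apply, Lp.toTemperedDistribution_apply] at h1
  calc ∫ x, g x • (𝓕 (hf₂.toLp f) : Lp X 2 (volume : Measure ℝ)) x
      = ∫ x, φ x • (𝓕 (hf₂.toLp f) : Lp X 2 (volume : Measure ℝ)) x := by simp [hφ]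
    _ = ∫ x, (𝓕 φ) x • (hf₂.toLp f) x := h1.symm
    _ = ∫ x, (𝓕 (φ : ℝ → ℂ)) x • f x := by
        refine integral_congr_ae ?_
        filter_upwards [hf₂.coeFn_toLp] with x hx
        rw [hx, SchwartzMap.fourier_coe]
    _ = ∫ x, φ x • 𝓕 f x := by
        have := VectorFourier.integral_fourierIntegral_smul_eq_flip (μ := volume) (ν := volume)
          (L := innerₗ ℝ) (f := φ) (g := f) Real.continuous_fourierChar
          (by exact continuous_inner) φ.integrable hf₁
        rwa [flip_innerₗ] at this
    _ = ∫ x, g x • 𝓕 f x := by simp [hφ]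

theorem eLpNorm_fourier_eq {f : ℝ → X} (hf₁ : Integrable f) (hf₂ : MemLp f 2) :
    eLpNorm (𝓕 f) 2 volume = eLpNorm f 2 volume := by
  have h := Lp.norm_fourier_eq (hf₂.toLp f)
  rw [Lp.norm_def, Lp.norm_def, ENNReal.toReal_eq_toReal_iff' (Lp.eLpNorm_ne_top _)
    (Lp.eLpNorm_ne_top _), eLpNorm_congr_ae hf₂.coeFn_toLp,
    eLpNorm_congr_ae (fourier_toLp_ae_eq hf₁ hf₂)] at h
  exact h

theorem integral_norm_sq_le_of_norm_fourier_le {f g : ℝ → X} (hf₁ : Integrable f)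
    (hf₂ : MemLp f 2) (hg₁ : Integrable g) (hg₂ : MemLp g 2) {B : ℝ} (hB : 0 ≤ B)
    (h : ∀ w, ‖𝓕 g w‖ ≤ B * ‖𝓕 f w‖) : ∫ t, ‖g t‖ ^ 2 ≤ B ^ 2 * ∫ t, ‖f t‖ ^ 2 := by
  have key : eLpNorm g 2 volume ≤ ENNReal.ofReal B * eLpNorm f 2 volume := by
    rw [← eLpNorm_fourier_eq hg₁ hg₂, ← eLpNorm_fourier_eq hf₁ hf₂]
    exact eLpNorm_le_mul_eLpNorm_of_ae_le_mul (.of_forall h) 2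
  have sq (u : ℝ → X) (hu : MemLp u 2) : ∫ t, ‖u t‖ ^ 2 = (eLpNorm u 2 volume).toReal ^ 2 := by
    have h0 : 0 ≤ ∫ t, ‖u t‖ ^ 2 := integral_nonneg fun t => by positivity
    rw [hu.eLpNorm_eq_integral_rpow_norm (by norm_num) (by norm_num),
      ENNReal.toReal_ofReal (by positivity)]
    simp [← Real.sqrt_eq_rpow, Real.sq_sqrt h0, ← one_div]
  rw [sq f hf₂, sq g hg₂, ← mul_pow]
  gcongr
  have := ENNReal.toReal_mono (ENNReal.mul_ne_top ENNReal.ofReal_ne_top hf₂.eLpNorm_ne_top) key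
  rwa [ENNReal.toReal_mul, ENNReal.toReal_ofReal hB] at this
end Plancherel

theorem integral_Ioi_of_hasDeriv_right_of_tendsto {E : Type*} [NormedAddCommGroup E]
    [NormedSpace ℝ E] [CompleteSpace E] {F F' : ℝ → E}
    (hcont : ContinuousOn F (Ici 0)) (hd : ∀ t > 0, HasDerivWithinAt F (F' t) (Ioi t) t)
    (hint : IntegrableOn F' (Ioi 0)) (hlim : Tendsto F atTop (𝓝 0)) :
    ∫ t in Ioi 0, F' t = - F 0 := by
  refine tendsto_nhds_unique (intervalIntegral_tendsto_integral_Ioi 0 hint tendsto_id) ?_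
  have : Tendsto (fun b => F b - F 0) atTop (𝓝 (- F 0)) := by simpa using hlim.sub_const (F 0)
  refine this.congr' ?_
  filter_upwards [eventually_ge_atTop 0] with b hb
  refine (intervalIntegral.integral_eq_sub_of_hasDeriv_right_of_le hb
    (hcont.mono Icc_subset_Ici_self) (fun t ht => hd t ht.1) ?_).symm
  exact (intervalIntegrable_iff_integrableOn_Ioc_of_le hb).2 (hint.mono_set Ioc_subset_Ioi_self)

section Semigroup
variable {X : Type*} [NormedAddCommGroup X] [NormedSpace ℂ X]

/-- `T` is a strongly continuous semigroup bounded by `c`. -/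
structure IsBoundedSemigroup (T : ℝ → X →L[ℂ] X) (c : ℝ) : Prop where
  zero : T 0 = 1
  add : ∀ s t : ℝ, 0 ≤ s → 0 ≤ t → T (s + t) = T s ∘L T t
  cont : ∀ x : X, ContinuousOn (fun t : ℝ => T t x) (Ici 0)
  bound : ∀ t : ℝ, 0 ≤ t → ‖T t‖ ≤ c

/-- `x` lies in the domain of the generator of `T`, which maps `x` to `y`. -/
def GeneratorRel (T : ℝ → X →L[ℂ] X) (x y : X) : Prop :=
  Tendsto (fun t : ℝ => (t : ℂ)⁻¹ • (T t x - x)) (𝓝[>] 0) (𝓝 y)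

variable {T : ℝ → X →L[ℂ] X} {c : ℝ}

namespace IsBoundedSemigroup

theorem nonneg (h : IsBoundedSemigroup T c) : 0 ≤ c := (norm_nonneg _).trans (h.bound 0 le_rfl)

theorem norm_apply_le (h : IsBoundedSemigroup T c) {t : ℝ} (ht : 0 ≤ t) (x : X) :
    ‖T t x‖ ≤ c * ‖x‖ :=
  (T t).le_of_opNorm_le (h.bound t ht) x

theorem generatorRel_apply (h : IsBoundedSemigroup T c) {x y : X} (hxy : GeneratorRel T x y)
    {t : ℝ} (ht : 0 ≤ t) : GeneratorRel T (T t x) (T t y) := by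
  refine (((T t).continuous.tendsto y).comp hxy).congr' ?_
  filter_upwards [self_mem_nhdsWithin] with s (hs : 0 < s)
  have : T s (T t x) = T t (T s x) := by
    rw [← ContinuousLinearMap.comp_apply, ← ContinuousLinearMap.comp_apply,
      ← h.add s t hs.le ht, ← h.add t s ht hs.le, add_comm]
  simp [this]

theorem hasDerivWithinAt (h : IsBoundedSemigroup T c) {x y : X} (hxy : GeneratorRel T x y)
    {t : ℝ} (ht : 0 ≤ t) : HasDerivWithinAt (fun s => T s x) (T t y) (Ioi t) t := by
  rw [hasDerivWithinAt_iff_tendsto_slope' (by simp)]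
  have h1 := h.generatorRel_apply hxy ht
  have h2 : Tendsto (fun s : ℝ => s - t) (𝓝[>] t) (𝓝[>] 0) := by
    refine tendsto_nhdsWithin_iff.2 ⟨?_, ?_⟩
    · have : Tendsto (fun s : ℝ => s - t) (𝓝 t) (𝓝 (t - t)) :=
        (continuous_id.sub continuous_const).tendsto t
      rw [sub_self] at this
      exact this.mono_left nhdsWithin_le_nhds
    · filter_upwards [self_mem_nhdsWithin] with s (hs : t < s)
      exact sub_pos.2 hs
  refine (h1.comp h2).congr' ?_
  filter_upwards [self_mem_nhdsWithin] with s (hs : t < s)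
  have : T s x = T (s - t) (T t x) := by
    rw [← ContinuousLinearMap.comp_apply, ← h.add _ _ (sub_pos.2 hs).le ht, sub_add_cancel]
  simp only [Function.comp_apply, slope, vsub_eq_sub, this]
  rw [← Complex.ofReal_inv, Complex.coe_smul]

/-- Derivative of the orbit weighted by an exponential and a power. -/
theorem hasDerivWithinAt_weighted (h : IsBoundedSemigroup T c) {x y z : X} {lam : ℂ}
    (hyz : GeneratorRel T y z) (hx : lam • y - z = x) (k : ℕ) {t : ℝ} (ht : 0 ≤ t) :
    HasDerivWithinAt (fun s : ℝ => ((s : ℂ) ^ k * Complex.exp (-lam * s)) • T s y)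
      (((k : ℂ) * (t : ℂ) ^ (k - 1) * Complex.exp (-lam * t)) • T t y
        - ((t : ℂ) ^ k * Complex.exp (-lam * t)) • T t x) (Ioi t) t := by
  have e0 : HasDerivAt (fun s : ℝ => (s : ℂ)) 1 t := by
    simpa using (hasDerivAt_id t).ofReal_comp
  have e1 : HasDerivAt (fun s : ℝ => (s : ℂ) ^ k * Complex.exp (-lam * s))
      ((k : ℂ) * (t : ℂ) ^ (k - 1) * 1 * Complex.exp (-lam * t)
        + (t : ℂ) ^ k * (Complex.exp (-lam * t) * (-lam * 1))) t :=
    (e0.pow k).mul (e0.const_mul (-lam)).cexp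
  refine (e1.hasDerivWithinAt.smul (h.hasDerivWithinAt hyz ht)).congr_deriv ?_
  rw [← hx, map_sub, map_smul]
  module

theorem integrableOn_weight {a : ℝ} (ha : 0 < a) (k : ℕ) :
    IntegrableOn (fun t : ℝ => t ^ k * Real.exp (-a * t)) (Ioi 0) := by
  have := integrableOn_rpow_mul_exp_neg_mul_rpow (s := k) (p := 1) (b := a)
    (by have : (0 : ℝ) ≤ k := k.cast_nonneg
        linarith) one_pos ha
  simpa using this

theorem norm_weight {lam : ℂ} (k : ℕ) {t : ℝ} (ht : 0 ≤ t) :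
    ‖(t : ℂ) ^ k * Complex.exp (-lam * t)‖ = t ^ k * Real.exp (-lam.re * t) := by
  simp [Complex.norm_exp, abs_of_nonneg ht]

theorem continuousOn_weighted (h : IsBoundedSemigroup T c) (lam : ℂ) (k : ℕ) (x : X) :
    ContinuousOn (fun t : ℝ => ((t : ℂ) ^ k * Complex.exp (-lam * t)) • T t x) (Ici 0) :=
  (Continuous.continuousOn (by fun_prop)).smul (h.cont x)

theorem norm_weighted_le (h : IsBoundedSemigroup T c) (lam : ℂ) (k : ℕ) (x : X) {t : ℝ}
    (ht : 0 ≤ t) : ‖((t : ℂ) ^ k * Complex.exp (-lam * t)) • T t x‖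
      ≤ t ^ k * Real.exp (-lam.re * t) * (c * ‖x‖) := by
  rw [norm_smul, norm_weight k ht]
  gcongr
  exact h.norm_apply_le ht x

theorem integrableOn_weighted (h : IsBoundedSemigroup T c) {lam : ℂ} (hlam : 0 < lam.re)
    (k : ℕ) (x : X) :
    IntegrableOn (fun t : ℝ => ((t : ℂ) ^ k * Complex.exp (-lam * t)) • T t x) (Ioi 0) := by
  refine Integrable.mono' ((integrableOn_weight hlam k).mul_const (c * ‖x‖))
    (((h.continuousOn_weighted lam k x).mono Ioi_subset_Ici_self).aestronglyMeasurable
      measurableSet_Ioi) ?_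
  filter_upwards [ae_restrict_mem measurableSet_Ioi] with t (ht : 0 < t)
  exact h.norm_weighted_le lam k x ht.le

theorem tendsto_weighted (h : IsBoundedSemigroup T c) {lam : ℂ} (hlam : 0 < lam.re)
    (k : ℕ) (x : X) :
    Tendsto (fun t : ℝ => ((t : ℂ) ^ k * Complex.exp (-lam * t)) • T t x) atTop (𝓝 0) := by
  have h1 : Tendsto (fun t : ℝ => t ^ k * Real.exp (-lam.re * t) * (c * ‖x‖)) atTop (𝓝 0) := by
    have := (tendsto_rpow_mul_exp_neg_mul_atTop_nhds_zero k lam.re hlam).mul_const (c * ‖x‖)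
    simpa using this
  refine squeeze_zero_norm' ?_ h1
  filter_upwards [eventually_ge_atTop 0] with t ht
  exact h.norm_weighted_le lam k x ht

theorem norm_le_norm_apply_add (h : IsBoundedSemigroup T c) {x y z : X} {lam : ℂ}
    (hlam : 0 < lam.re) (hyz : GeneratorRel T y z) (hx : lam • y - z = x) {t : ℝ} (ht : 0 ≤ t) :
    ‖y‖ ≤ ‖T t y‖ + c * ‖x‖ * t := by
  have exp_le {s : ℝ} (hs : 0 ≤ s) : Real.exp (-lam.re * s) ≤ 1 := by
    rw [Real.exp_le_one_iff]; nlinarith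
  have := norm_image_sub_le_of_norm_deriv_right_le_segment (a := 0) (b := t) (C := c * ‖x‖)
    ((h.continuousOn_weighted lam 0 y).mono Icc_subset_Ici_self)
    (fun s hs => hasDerivWithinAt_Ioi_iff_Ici.1 (h.hasDerivWithinAt_weighted hyz hx 0 hs.1))
    (fun s hs => ?_) t ⟨ht, le_rfl⟩
  · rw [sub_zero, h.zero] at this
    have h2 := norm_smul_le (((t : ℂ) ^ 0 * Complex.exp (-lam * t))) (T t y)
    rw [norm_weight 0 ht] at h2
    have h3 := mul_le_mul_of_nonneg_right (exp_le ht) (norm_nonneg (T t y))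
    have h4 := norm_le_norm_add_norm_sub (((t : ℂ) ^ 0 * Complex.exp (-lam * t)) • T t y) y
    simp at *
    linarith
  · have h5 := h.norm_weighted_le lam 0 x hs.1
    have h6 := mul_le_mul_of_nonneg_right (exp_le hs.1) (mul_nonneg h.nonneg (norm_nonneg x))
    simp at *
    linarith

/-- First-order Taylor estimate, giving a Landau-Kolmogorov inequality for the generator. -/
theorem mul_norm_le_add_sq_mul (h : IsBoundedSemigroup T c) {x y z : X}
    (hxy : GeneratorRel T x y) (hyz : GeneratorRel T y z) {t : ℝ} (ht : 0 ≤ t) :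
    t * ‖y‖ ≤ (1 + c) * ‖x‖ + c * ‖z‖ * t ^ 2 := by
  have hd1 (s : ℝ) (hs : 0 ≤ s) : ‖T s y - y‖ ≤ c * ‖z‖ * s := by
    have := norm_image_sub_le_of_norm_deriv_right_le_segment (a := 0) (b := s) (C := c * ‖z‖)
      ((h.cont y).mono Icc_subset_Ici_self)
      (fun r hr => hasDerivWithinAt_Ioi_iff_Ici.1 (h.hasDerivWithinAt hyz hr.1))
      (fun r hr => h.norm_apply_le hr.1 z) s ⟨hs, le_rfl⟩
    simpa [h.zero] using this
  have hd2 := norm_image_sub_le_of_norm_deriv_right_le_segment (a := 0) (b := t)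
    (C := c * ‖z‖ * t) (f := fun s => T s x - s • y) (f' := fun s => T s y - (1 : ℝ) • y)
    (((h.cont x).mono Icc_subset_Ici_self).sub (by fun_prop))
    (fun r hr => (hasDerivWithinAt_Ioi_iff_Ici.1 (h.hasDerivWithinAt hxy hr.1)).sub
      ((hasDerivWithinAt_id r _).smul_const y))
    (fun r hr => by
      rw [one_smul]
      refine (hd1 r hr.1).trans ?_
      exact mul_le_mul_of_nonneg_left hr.2.le (mul_nonneg h.nonneg (norm_nonneg z)))
    t ⟨ht, le_rfl⟩
  simp only [h.zero, zero_smul, sub_zero, one_apply_eq_self] at hd2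
  have h1 := h.norm_apply_le ht x
  have h2 : ‖t • y‖ ≤ ‖T t x - t • y - x‖ + ‖T t x‖ + ‖x‖ := by
    calc ‖t • y‖ = ‖T t x - (T t x - t • y - x) - x‖ := by congr 1; abel
      _ ≤ ‖T t x‖ + ‖T t x - t • y - x‖ + ‖x‖ :=
        (norm_sub_le _ _).trans (by gcongr; exact norm_sub_le _ _)
      _ = _ := by ring
  rw [norm_smul, Real.norm_of_nonneg ht] at h2
  nlinarith

variable [CompleteSpace X]

theorem integral_weighted_sub (h : IsBoundedSemigroup T c) {x y z : X} {lam : ℂ}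
    (hlam : 0 < lam.re) (hyz : GeneratorRel T y z) (hx : lam • y - z = x) (k : ℕ) :
    (k : ℂ) • (∫ t in Ioi (0 : ℝ), ((t : ℂ) ^ (k - 1) * Complex.exp (-lam * t)) • T t y)
      - ∫ t in Ioi (0 : ℝ), ((t : ℂ) ^ k * Complex.exp (-lam * t)) • T t x
      = - ((0 : ℂ) ^ k • y) := by
  have := integral_Ioi_of_hasDeriv_right_of_tendsto (h.continuousOn_weighted lam k y)
    (fun t ht => h.hasDerivWithinAt_weighted hyz hx k (le_of_lt ht)) ?_ (h.tendsto_weighted hlam k y)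
  · simp only [mul_assoc, mul_smul] at this ⊢
    rw [integral_sub, integral_smul] at this
    · simpa [h.zero] using this
    · exact ((h.integrableOn_weighted hlam (k - 1) y).smul (k : ℂ)).congr
        (.of_forall fun t => by simp [mul_smul])
    · exact (h.integrableOn_weighted hlam k x).congr (.of_forall fun t => by simp [mul_smul])
  · refine Integrable.sub ?_ (h.integrableOn_weighted hlam k x)
    exact ((h.integrableOn_weighted hlam (k - 1) y).smul (k : ℂ)).congr
      (.of_forall fun t => by simp [mul_smul])

theorem integral_exp_smul (h : IsBoundedSemigroup T c) {x y z : X} {lam : ℂ}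
    (hlam : 0 < lam.re) (hyz : GeneratorRel T y z) (hx : lam • y - z = x) :
    ∫ t in Ioi (0 : ℝ), ((t : ℂ) ^ 0 * Complex.exp (-lam * t)) • T t x = y := by
  simpa using h.integral_weighted_sub hlam hyz hx 0

theorem integral_id_mul_exp_smul (h : IsBoundedSemigroup T c) {x y z v w : X} {lam : ℂ}
    (hlam : 0 < lam.re) (hyz : GeneratorRel T y z) (hx : lam • y - z = x)
    (hvw : GeneratorRel T v w) (hy : lam • v - w = y) :
    ∫ t in Ioi (0 : ℝ), ((t : ℂ) ^ 1 * Complex.exp (-lam * t)) • T t x = v := by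
  have := h.integral_weighted_sub hlam hyz hx 1
  rw [Nat.sub_self, h.integral_exp_smul hlam hvw hy] at this
  rw [Nat.cast_one, one_smul, pow_one, zero_smul, neg_zero, sub_eq_zero] at this
  exact this.symm

theorem norm_le_div_re (h : IsBoundedSemigroup T c) {x y z : X} {lam : ℂ}
    (hlam : 0 < lam.re) (hyz : GeneratorRel T y z) (hx : lam • y - z = x) :
    ‖y‖ ≤ c * ‖x‖ / lam.re := by
  rw [← h.integral_exp_smul hlam hyz hx]
  refine (norm_integral_le_of_norm_le ((integrableOn_weight hlam 0).mul_const (c * ‖x‖)) ?_).trans ?_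
  · filter_upwards [ae_restrict_mem measurableSet_Ioi] with t (ht : 0 < t)
    exact h.norm_weighted_le lam 0 x ht.le
  · rw [integral_mul_const]
    simp only [pow_zero, one_mul]
    rw [integral_exp_mul_Ioi (by linarith)]
    simp
    apply le_of_eq
    ring

end IsBoundedSemigroup
end Semigroup

/-- Iterated form of a Landau-Kolmogorov type inequality for a sequence. -/
theorem exists_pow_le_mul_of_sq_le {C : ℝ} (hC : 0 ≤ C) (k : ℕ) : ∃ C' : ℝ, 0 ≤ C' ∧
    ∀ N : ℕ → ℝ, (∀ j, 0 ≤ N j) → (∀ j, N (j + 1) ^ 2 ≤ C * (N j * N (j + 2))) →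
      N 1 ^ (k + 1) ≤ C' * (N 0 ^ k * N (k + 1)) := by
  induction k with
  | zero => exact ⟨1, zero_le_one, fun N _ _ => by simp⟩
  | succ k ih =>
    obtain ⟨C', hC', h⟩ := ih
    refine ⟨C ^ (k + 1) * C', by positivity, fun N h0 hN => ?_⟩
    have h2 : N 2 ^ (k + 1) ≤ C' * (N 1 ^ k * N (k + 2)) :=
      h (fun j => N (j + 1)) (fun j => h0 _) (fun j => hN _)
    have h3 : N 1 ^ k * N 1 ^ (k + 2) ≤
        N 1 ^ k * (C ^ (k + 1) * C' * (N 0 ^ (k + 1) * N (k + 2))) :=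
      calc N 1 ^ k * N 1 ^ (k + 2) = (N 1 ^ 2) ^ (k + 1) := by ring
        _ ≤ (C * (N 0 * N 2)) ^ (k + 1) := by
          gcongr
          exact hN 0
        _ = C ^ (k + 1) * N 0 ^ (k + 1) * N 2 ^ (k + 1) := by ring
        _ ≤ C ^ (k + 1) * N 0 ^ (k + 1) * (C' * (N 1 ^ k * N (k + 2))) := by
          have := h0 0
          gcongr
        _ = _ := by ring
    rcases (h0 1).eq_or_lt with h1 | h1
    · rw [← h1, zero_pow (by omega)]
      have := h0 0
      have := h0 (k + 2)
      positivity
    · exact le_of_mul_le_mul_left h3 (by positivity)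

namespace IsBoundedSemigroup

section Inverse
variable {X : Type*} [NormedAddCommGroup X] [NormedSpace ℂ X] {T : ℝ → X →L[ℂ] X} {c : ℝ}
  {Ainv : X →L[ℂ] X}

theorem commute_inverse (h : IsBoundedSemigroup T c) (hA : ∀ x, GeneratorRel T (Ainv x) x)
    (hA' : ∀ x y, GeneratorRel T x y → Ainv y = x) {t : ℝ} (ht : 0 ≤ t) :
    Commute (T t) Ainv := by
  ext x
  exact (hA' _ _ (h.generatorRel_apply (hA x) ht)).symm

theorem norm_inverse_pow_comp_sq_le (h : IsBoundedSemigroup T c)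
    (hA : ∀ x, GeneratorRel T (Ainv x) x) (t : ℝ) (k : ℕ) :
    ‖Ainv ^ (k + 1) * T t‖ ^ 2 ≤
      4 * (1 + c) ^ 2 * (‖Ainv ^ k * T t‖ * ‖Ainv ^ (k + 2) * T t‖) := by
  have hc := h.nonneg
  have key : ∀ s : ℝ, 0 ≤ (1 + c) * ‖Ainv ^ k * T t‖ * (s * s)
      + -‖Ainv ^ (k + 1) * T t‖ * s + (1 + c) * ‖Ainv ^ (k + 2) * T t‖ := by
    intro s
    rcases le_total s 0 with hs | hs
    · have : 0 ≤ ‖Ainv ^ (k + 1) * T t‖ * (-s) := mul_nonneg (norm_nonneg _) (by linarith)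
      have h2 : 0 ≤ (1 + c) * ‖Ainv ^ k * T t‖ * (s * s) := by
        have := mul_self_nonneg s
        positivity
      have h3 : 0 ≤ (1 + c) * ‖Ainv ^ (k + 2) * T t‖ := by positivity
      linarith
    · have : ‖(s : ℂ) • (Ainv ^ (k + 1) * T t)‖ ≤
          (1 + c) * ‖Ainv ^ (k + 2) * T t‖ + c * ‖Ainv ^ k * T t‖ * s ^ 2 := by
        refine ContinuousLinearMap.opNorm_le_bound _ (by positivity) fun u => ?_
        have e1 (j : ℕ) : Ainv ((Ainv ^ j * T t) u) = (Ainv ^ (j + 1) * T t) u := by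
          rw [pow_succ']; rfl
        have h1 := h.mul_norm_le_add_sq_mul (hA ((Ainv ^ (k + 1) * T t) u))
          (e1 k ▸ hA ((Ainv ^ k * T t) u)) hs
        rw [e1] at h1
        have h2 := (Ainv ^ (k + 2) * T t).le_opNorm u
        have h3 := (Ainv ^ k * T t).le_opNorm u
        rw [smul_apply, norm_smul, Complex.norm_of_nonneg hs]
        calc _ ≤ _ := h1
          _ ≤ (1 + c) * (‖Ainv ^ (k + 2) * T t‖ * ‖u‖)
              + c * (‖Ainv ^ k * T t‖ * ‖u‖) * s ^ 2 := by gcongr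
          _ = _ := by ring
      rw [norm_smul, Complex.norm_of_nonneg hs] at this
      nlinarith [mul_nonneg (norm_nonneg (Ainv ^ k * T t)) (sq_nonneg s)]
  have := discrim_le_zero key
  rw [discrim] at this
  nlinarith

end Inverse

section Hilbert
variable {X : Type*} [NormedAddCommGroup X] [InnerProductSpace ℂ X]
  {T : ℝ → X →L[ℂ] X} {c : ℝ}

theorem fourier_indicator_weighted (ξ : ℝ) (k : ℕ) (x : X) (w : ℝ) :
    𝓕 ((Ioi (0 : ℝ)).indicator
      fun t : ℝ => ((t : ℂ) ^ k * Complex.exp (-(ξ : ℂ) * t)) • T t x) w =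
    ∫ t in Ioi (0 : ℝ),
      ((t : ℂ) ^ k * Complex.exp (-(ξ + 2 * Real.pi * w * Complex.I) * t)) • T t x := by
  rw [Real.fourier_eq', ← integral_indicator measurableSet_Ioi]
  congr 1 with t
  by_cases ht : t ∈ Ioi (0 : ℝ)
  · simp only [indicator_of_mem ht, smul_smul]
    congr 1
    rw [mul_left_comm, ← Complex.exp_add]
    congr 2
    simp
    ring
  · simp [indicator_of_notMem ht]

theorem integrable_indicator_weighted (h : IsBoundedSemigroup T c) {ξ : ℝ} (hξ : 0 < ξ)
    (k : ℕ) (x : X) : Integrable ((Ioi (0 : ℝ)).indicator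
      fun t : ℝ => ((t : ℂ) ^ k * Complex.exp (-(ξ : ℂ) * t)) • T t x) :=
  (integrable_indicator_iff measurableSet_Ioi).2
    (h.integrableOn_weighted (by simpa using hξ) k x)

theorem norm_sq_indicator_weighted_le (h : IsBoundedSemigroup T c) (ξ : ℝ)
    (k : ℕ) (x : X) (t : ℝ) : ‖(Ioi (0 : ℝ)).indicator
      (fun t : ℝ => ((t : ℂ) ^ k * Complex.exp (-(ξ : ℂ) * t)) • T t x) t‖ ^ 2 ≤
      (Ioi (0 : ℝ)).indicator
        (fun t : ℝ => t ^ (2 * k) * Real.exp (-(2 * ξ) * t) * (c * ‖x‖) ^ 2) t := by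
  by_cases ht : t ∈ Ioi (0 : ℝ)
  · rw [indicator_of_mem ht, indicator_of_mem ht]
    refine (pow_le_pow_left₀ (norm_nonneg _) (h.norm_weighted_le ξ k x (le_of_lt ht)) 2).trans ?_
    rw [mul_pow, mul_pow, ← pow_mul, mul_comm k 2, ← Real.exp_nat_mul]
    simp [mul_assoc]
  · simp [indicator_of_notMem ht]

theorem memLp_indicator_weighted (h : IsBoundedSemigroup T c) {ξ : ℝ} (hξ : 0 < ξ)
    (k : ℕ) (x : X) : MemLp ((Ioi (0 : ℝ)).indicator
      fun t : ℝ => ((t : ℂ) ^ k * Complex.exp (-(ξ : ℂ) * t)) • T t x) 2 := by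
  have hm := (h.integrable_indicator_weighted hξ k x).aestronglyMeasurable
  rw [memLp_two_iff_integrable_sq_norm hm]
  refine Integrable.mono' ((integrable_indicator_iff measurableSet_Ioi).2
    ((integrableOn_weight (a := 2 * ξ) (by positivity) (2 * k)).mul_const ((c * ‖x‖) ^ 2)))
    (hm.norm.pow 2) (.of_forall fun t => ?_)
  rw [Real.norm_of_nonneg (by positivity)]
  exact h.norm_sq_indicator_weighted_le ξ k x t

theorem integral_norm_sq_exp_le (h : IsBoundedSemigroup T c) {ξ : ℝ} (hξ : 0 < ξ) (x : X) :
    ∫ t, ‖(Ioi (0 : ℝ)).indicator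
      (fun t : ℝ => ((t : ℂ) ^ 0 * Complex.exp (-(ξ : ℂ) * t)) • T t x) t‖ ^ 2 ≤
      (c * ‖x‖) ^ 2 / (2 * ξ) := by
  have hi := (integrableOn_weight (a := 2 * ξ) (by positivity) (2 * 0)).mul_const ((c * ‖x‖) ^ 2)
  refine (integral_mono ((h.memLp_indicator_weighted hξ 0 x).integrable_norm_pow two_ne_zero)
    ((integrable_indicator_iff measurableSet_Ioi).2 hi)
    (h.norm_sq_indicator_weighted_le ξ 0 x)).trans ?_
  rw [integral_indicator measurableSet_Ioi, integral_mul_const]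
  simp only [mul_zero, pow_zero, one_mul]
  rw [integral_exp_mul_Ioi (by linarith)]
  apply le_of_eq
  simp
  ring

/-- A resolvent bound for `L` on the line `Re λ = 1 / t` yields a bound for `L T(t)`. -/
theorem norm_apply_le_of_resolvent [CompleteSpace X] (h : IsBoundedSemigroup T c) {R : ℂ → X →L[ℂ] X}
    (hR : ∀ lam : ℂ, 0 < lam.re → ∀ x, GeneratorRel T (R lam x) (lam • R lam x - x))
    {L : X →L[ℂ] X} (hL : ∀ t : ℝ, 0 ≤ t → Commute (T t) L) {t B : ℝ} (ht : 0 < t) (hB : 0 ≤ B)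
    (hLR : ∀ lam : ℂ, lam.re = t⁻¹ → ∀ x, ‖L (R lam x)‖ ≤ B * ‖x‖) (x : X) :
    ‖L (T t x)‖ ≤ 2 * Real.exp 1 * c ^ 2 * B * ‖x‖ / t := by
  have hc := h.nonneg
  have hξ : 0 < t⁻¹ := inv_pos.2 ht
  set f := fun k : ℕ => (Ioi (0 : ℝ)).indicator
    fun s : ℝ => ((s : ℂ) ^ k * Complex.exp (-((t⁻¹ : ℝ) : ℂ) * s)) • T s x with hf
  have hf₁ k : Integrable (f k) := h.integrable_indicator_weighted hξ k x
  have hf₂ k : MemLp (f k) 2 := h.memLp_indicator_weighted hξ k x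
  have hF (w : ℝ) : ‖𝓕 (fun s => L (f 1 s)) w‖ ≤ B * ‖𝓕 (f 0) w‖ := by
    have e : 𝓕 (fun s => L (f 1 s)) w = L (𝓕 (f 1) w) := by
      rw [Real.fourier_eq', Real.fourier_eq', ← L.integral_comp_comm]
      · simp
      · simpa [Real.fourierChar_apply, Circle.smul_def] using
          (Real.fourierIntegral_convergent_iff (μ := volume) w).2 (hf₁ 1)
    set lam : ℂ := ((t⁻¹ : ℝ) : ℂ) + 2 * Real.pi * w * Complex.I with hlam
    have hre : lam.re = t⁻¹ := by simp [hlam]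
    have hpos : 0 < lam.re := hre ▸ hξ
    have e0 : 𝓕 (f 0) w = R lam x :=
      (fourier_indicator_weighted t⁻¹ 0 x w).trans
        (h.integral_exp_smul hpos (hR lam hpos x) (sub_sub_cancel _ _))
    have e1 : 𝓕 (f 1) w = R lam (R lam x) :=
      (fourier_indicator_weighted t⁻¹ 1 x w).trans
        (h.integral_id_mul_exp_smul hpos (hR lam hpos x) (sub_sub_cancel _ _) (hR lam hpos _)
          (sub_sub_cancel _ _))
    rw [e, e0, e1]
    exact hLR lam hre _
  have up := integral_norm_sq_le_of_norm_fourier_le (hf₁ 0) (hf₂ 0) (L.integrable_comp (hf₁ 1))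
    (L.comp_memLp' (hf₂ 1)) hB hF
  have up2 := h.integral_norm_sq_exp_le hξ x
  have hint : Integrable fun s => ‖L (f 1 s)‖ ^ 2 :=
    (memLp_two_iff_integrable_sq_norm (L.integrable_comp (hf₁ 1)).aestronglyMeasurable).1
      (L.comp_memLp' (hf₂ 1))
  set Q := ‖L (T t x)‖ with hQ
  have low (s : ℝ) (hs : s ∈ Ioc (t / 2) t) :
      (t / 2 * Real.exp (-1) * Q) ^ 2 ≤ c ^ 2 * ‖L (f 1 s)‖ ^ 2 := by
    have hs0 : 0 < s := (half_pos ht).trans hs.1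
    have e1 : Q ≤ c * ‖L (T s x)‖ := by
      have a1 : L (T t x) = T (t - s) (L (T s x)) := by
        have b1 := congrArg (fun S : X →L[ℂ] X => S (T s x)) (hL (t - s) (sub_nonneg.2 hs.2)).eq
        have b2 := h.add (t - s) s (sub_nonneg.2 hs.2) hs0.le
        rw [sub_add_cancel] at b2
        rw [b2]
        exact b1.symm
      rw [hQ, a1]
      exact h.norm_apply_le (sub_nonneg.2 hs.2) _
    have e2 : ‖L (f 1 s)‖ = s * Real.exp (-(t⁻¹ * s)) * ‖L (T s x)‖ := by
      have := norm_weight (lam := ((t⁻¹ : ℝ) : ℂ)) 1 hs0.le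
      rw [hf]
      simp only [indicator_of_mem (show s ∈ Ioi (0 : ℝ) from hs0), map_smul, norm_smul, this]
      simp
    have e3 : Real.exp (-1) ≤ Real.exp (-(t⁻¹ * s)) := by
      gcongr
      rw [inv_mul_eq_div]
      exact (div_le_one ht).2 hs.2
    rw [← mul_pow, e2]
    refine pow_le_pow_left₀ (by positivity) ?_ 2
    calc t / 2 * Real.exp (-1) * Q
        ≤ s * Real.exp (-(t⁻¹ * s)) * (c * ‖L (T s x)‖) := by
          gcongr
          exact hs.1.le
      _ = c * (s * Real.exp (-(t⁻¹ * s)) * ‖L (T s x)‖) := by ring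
  have low2 : t / 2 * (t / 2 * Real.exp (-1) * Q) ^ 2 ≤ c ^ 2 * ∫ s, ‖L (f 1 s)‖ ^ 2 := by
    calc t / 2 * (t / 2 * Real.exp (-1) * Q) ^ 2
        = ∫ s in Ioc (t / 2) t, (t / 2 * Real.exp (-1) * Q) ^ 2 := by
          rw [setIntegral_const, Real.volume_real_Ioc_of_le (by linarith), smul_eq_mul]
          ring
      _ ≤ ∫ s in Ioc (t / 2) t, c ^ 2 * ‖L (f 1 s)‖ ^ 2 :=
          setIntegral_mono_on (integrableOn_const (by simp)) (hint.const_mul _).integrableOn measurableSet_Ioc low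
      _ ≤ ∫ s, c ^ 2 * ‖L (f 1 s)‖ ^ 2 :=
          setIntegral_le_integral (hint.const_mul _) (.of_forall fun s => by positivity)
      _ = _ := integral_const_mul _ _
  have fin : t / 2 * (t / 2 * Real.exp (-1) * Q) ^ 2 ≤
      c ^ 2 * (B ^ 2 * ((c * ‖x‖) ^ 2 / (2 * t⁻¹))) :=
    low2.trans (by gcongr; exact up.trans (by gcongr))
  have fin2 : (t / 2 * Real.exp (-1) * Q) ^ 2 ≤ (c * (B * (c * ‖x‖))) ^ 2 := by
    refine le_of_mul_le_mul_left (fin.trans_eq ?_) (half_pos ht)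
    field_simp
  have fin3 := abs_le_of_sq_le_sq' fin2 (by positivity) |>.2
  rw [le_div_iff₀ ht]
  have e : Real.exp 1 * Real.exp (-1) = 1 := by rw [← Real.exp_add]; simp
  calc Q * t = 2 * Real.exp 1 * (t / 2 * Real.exp (-1) * Q) := by linear_combination (-(Q*t)) * e
    _ ≤ 2 * Real.exp 1 * (c * (B * (c * ‖x‖))) := by gcongr
    _ = _ := by ring

end Hilbert
end IsBoundedSemigroup

theorem exists_norm_pow_apply_le {X : Type*} [NormedAddCommGroup X] [NormedSpace ℂ X]
    (Ainv : X →L[ℂ] X) (n : ℕ) :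
    ∃ C : ℝ, 0 ≤ C ∧ ∀ (lam : ℂ) (x y : X), 1 ≤ ‖lam‖ → Ainv (lam • y - x) = y →
      ‖(Ainv ^ n) y‖ ≤ (‖lam‖ ^ n)⁻¹ * ‖y‖ + C * ‖lam‖⁻¹ * ‖x‖ := by
  induction n with
  | zero => exact ⟨0, le_rfl, fun lam x y _ _ => by simp⟩
  | succ n ih =>
    obtain ⟨C, hC, h⟩ := ih
    refine ⟨C + ‖Ainv ^ (n + 1)‖, by positivity, fun lam x y hlam hy => ?_⟩
    have hpos : 0 < ‖lam‖ := by linarith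
    have e : lam • (Ainv ^ (n + 1)) y = (Ainv ^ n) y + (Ainv ^ (n + 1)) x := by
      have : (Ainv ^ (n + 1)) (lam • y - x) = (Ainv ^ n) y := by
        rw [pow_succ, mul_apply_eq_comp, hy]
      rw [map_sub, map_smul, sub_eq_iff_eq_add] at this
      exact this
    have h1 : ‖lam‖ * ‖(Ainv ^ (n + 1)) y‖ ≤
        (‖lam‖ ^ n)⁻¹ * ‖y‖ + C * ‖lam‖⁻¹ * ‖x‖ + ‖Ainv ^ (n + 1)‖ * ‖x‖ := by
      rw [← norm_smul, e]
      exact (norm_add_le _ _).trans (add_le_add (h lam x y hlam hy)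
        ((Ainv ^ (n + 1)).le_opNorm x))
    have h2 : C * ‖lam‖⁻¹ * ‖x‖ ≤ C * ‖x‖ := by
      gcongr
      exact mul_le_of_le_one_right hC (inv_le_one_of_one_le₀ hlam)
    calc ‖(Ainv ^ (n + 1)) y‖ = ‖lam‖⁻¹ * (‖lam‖ * ‖(Ainv ^ (n + 1)) y‖) := by field_simp
      _ ≤ ‖lam‖⁻¹ * ((‖lam‖ ^ n)⁻¹ * ‖y‖ + C * ‖x‖ + ‖Ainv ^ (n + 1)‖ * ‖x‖) := by
          gcongr
          linarith
      _ = _ := by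
          rw [pow_succ ‖lam‖ n, mul_inv]
          ring

namespace IsBoundedSemigroup

theorem exists_decay_of_resolvent_bound {X : Type*} [NormedAddCommGroup X]
    [InnerProductSpace ℂ X] [CompleteSpace X] {T : ℝ → X →L[ℂ] X} {c : ℝ}
    (h : IsBoundedSemigroup T c) {Ainv : X →L[ℂ] X} (hA : ∀ x, GeneratorRel T (Ainv x) x)
    (hA' : ∀ x y, GeneratorRel T x y → Ainv y = x) {R : ℂ → X →L[ℂ] X}
    (hR : ∀ lam : ℂ, 0 < lam.re → ∀ x, GeneratorRel T (R lam x) (lam • R lam x - x))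
    {n : ℕ} (hn : 1 ≤ n) {p K : ℝ} (hp : 1 ≤ p) (hK : 0 < K)
    (hb : ∀ lam : ℂ, 0 < lam.re → ∀ x,
      ‖(Ainv ^ n) (R lam x)‖ ≤ K * ‖x‖ / lam.re ^ (1 - 1 / p)) :
    ∃ M > 0, ∀ t : ℝ, 0 < t → ‖T t * Ainv‖ ≤ M * t ^ (-(1 / ((n : ℝ) * p))) := by
  have hc := h.nonneg
  obtain ⟨k, rfl⟩ : ∃ k, n = k + 1 := ⟨n - 1, by omega⟩
  obtain ⟨C, hC, hseq⟩ := exists_pow_le_mul_of_sq_le (C := 4 * (1 + c) ^ 2) (by positivity) k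
  set D := 2 * Real.exp 1 * c ^ 2 * K with hD
  have hD0 : 0 ≤ D := by positivity
  set E := C * (c ^ k * D) with hE
  have hE0 : 0 ≤ E := by positivity
  have hn0 : (0 : ℝ) < ((k + 1 : ℕ) : ℝ) := by positivity
  refine ⟨E ^ (1 / ((k + 1 : ℕ) : ℝ)) + 1, by positivity, fun t ht => ?_⟩
  have hcomm {s : ℝ} (hs : 0 ≤ s) : Commute (T s) Ainv := h.commute_inverse hA hA' hs
  have hbound : ‖Ainv ^ (k + 1) * T t‖ ≤ D * t ^ (-(1 / p)) := by
    refine ContinuousLinearMap.opNorm_le_bound _ (by positivity) fun x => ?_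
    have := h.norm_apply_le_of_resolvent hR (fun s hs => (hcomm hs).pow_right (k + 1)) ht
      (B := K * t ^ (1 - 1 / p)) (by positivity) (fun lam hlam x => by
        have := hb lam (hlam ▸ inv_pos.2 ht) x
        rw [hlam, Real.inv_rpow ht.le, div_inv_eq_mul] at this
        linarith) x
    refine this.trans_eq ?_
    rw [show -(1 / p) = (1 - 1 / p) - 1 by ring, Real.rpow_sub_one ht.ne']
    ring
  have h1 := hseq (fun j => ‖Ainv ^ j * T t‖) (fun j => norm_nonneg _)
    (h.norm_inverse_pow_comp_sq_le hA t)
  simp only [pow_one, pow_zero, one_mul] at h1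
  have h2 : ‖Ainv * T t‖ ^ (k + 1) ≤ E * t ^ (-(1 / p)) := by
    refine h1.trans ?_
    calc C * (‖T t‖ ^ k * ‖Ainv ^ (k + 1) * T t‖)
        ≤ C * (c ^ k * (D * t ^ (-(1 / p)))) := by
          have := h.bound t ht.le
          gcongr
      _ = _ := by rw [hE]; ring
  rw [(hcomm ht.le).eq]
  calc ‖Ainv * T t‖ = (‖Ainv * T t‖ ^ (k + 1)) ^ (1 / ((k + 1 : ℕ) : ℝ)) := by
        rw [one_div, Real.pow_rpow_inv_natCast (norm_nonneg _) (by omega)]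
    _ ≤ (E * t ^ (-(1 / p))) ^ (1 / ((k + 1 : ℕ) : ℝ)) := by gcongr
    _ = E ^ (1 / ((k + 1 : ℕ) : ℝ)) * t ^ (-(1 / (((k + 1 : ℕ) : ℝ) * p))) := by
        rw [Real.mul_rpow hE0 (by positivity), ← Real.rpow_mul ht.le]
        congr 2
        field_simp
    _ ≤ _ := by
        gcongr
        linarith

section Banach
variable {X : Type*} [NormedAddCommGroup X] [NormedSpace ℂ X] {T : ℝ → X →L[ℂ] X} {c : ℝ}
  {Ainv : X →L[ℂ] X}

/-- Polynomial decay of `T(t)A⁻¹` bounds the growth of the resolvent. -/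
theorem exists_norm_le_rpow_of_decay (h : IsBoundedSemigroup T c)
    (hA' : ∀ x y, GeneratorRel T x y → Ainv y = x) {α M t₁ : ℝ} (hα : 0 < α) (hM : 0 < M)
    (ht₁ : 0 < t₁) (hdec : ∀ t : ℝ, t₁ ≤ t → ‖T t * Ainv‖ ≤ M * t ^ (-(1 / α))) :
    ∃ C : ℝ, 0 ≤ C ∧ ∀ (lam : ℂ) (x y : X), 0 < lam.re → GeneratorRel T y (lam • y - x) →
      ‖y‖ ≤ C * (1 + ‖lam‖) ^ α * ‖x‖ := by
  have hc := h.nonneg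
  set t₀ := max t₁ ((2 * M) ^ α) with ht₀
  have ht₀pos : 0 < t₀ := lt_max_of_lt_left ht₁
  refine ⟨1 + 2 * c * t₀, by positivity, fun lam x y hlam hy => ?_⟩
  set s := 1 + ‖lam‖ with hs
  have hs1 : 1 ≤ s := by simp [hs]
  have hsα : 1 ≤ s ^ α := Real.one_le_rpow hs1 hα.le
  set t := t₀ * s ^ α with ht
  have htpos : 0 < t := by positivity
  have hdt : M * t ^ (-(1 / α)) ≤ 1 / 2 * s⁻¹ := by
    have e1 : t ^ (-(1 / α)) = t₀ ^ (-(1 / α)) * s⁻¹ := by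
      rw [ht, Real.mul_rpow ht₀pos.le (by positivity), ← Real.rpow_mul (by positivity),
        show α * -(1 / α) = -1 by field_simp, Real.rpow_neg_one]
    have e2 : t₀ ^ (-(1 / α)) ≤ (2 * M)⁻¹ := by
      calc t₀ ^ (-(1 / α)) ≤ ((2 * M) ^ α) ^ (-(1 / α)) :=
            Real.rpow_le_rpow_of_nonpos (by positivity) (le_max_right _ _)
              (neg_nonpos.2 (by positivity))
        _ = (2 * M)⁻¹ := by
            rw [← Real.rpow_mul (by positivity), show α * -(1 / α) = -1 by field_simp,
              Real.rpow_neg_one]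
    rw [e1]
    calc M * (t₀ ^ (-(1 / α)) * s⁻¹) ≤ M * ((2 * M)⁻¹ * s⁻¹) := by gcongr
      _ = _ := by field_simp
  have h1 := h.norm_le_norm_apply_add hlam hy (sub_sub_cancel _ _) htpos.le
  have h2 : ‖T t y‖ ≤ 1 / 2 * s⁻¹ * (‖lam‖ * ‖y‖ + ‖x‖) := by
    have e : T t y = (T t * Ainv) (lam • y - x) := by
      rw [mul_apply_eq_comp, hA' _ _ hy]
    rw [e]
    refine (ContinuousLinearMap.le_opNorm _ _).trans ?_
    refine mul_le_mul ((hdec t ?_).trans hdt) ?_ (norm_nonneg _) (by positivity)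
    · exact (le_max_left _ _).trans (le_mul_of_one_le_right ht₀pos.le hsα)
    · exact (norm_sub_le _ _).trans_eq (by rw [norm_smul])
  have h3 : 1 / 2 * s⁻¹ * (‖lam‖ * ‖y‖ + ‖x‖) ≤ 1 / 2 * (‖y‖ + ‖x‖) := by
    have : ‖lam‖ * ‖y‖ + ‖x‖ ≤ s * (‖y‖ + ‖x‖) := by
      rw [hs]
      nlinarith [norm_nonneg lam, norm_nonneg y, norm_nonneg x,
        mul_nonneg (norm_nonneg lam) (norm_nonneg x)]
    calc 1 / 2 * s⁻¹ * (‖lam‖ * ‖y‖ + ‖x‖) ≤ 1 / 2 * s⁻¹ * (s * (‖y‖ + ‖x‖)) := by gcongr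
      _ = _ := by field_simp
  have h4 : ‖y‖ ≤ ‖x‖ + 2 * c * t * ‖x‖ := by linarith
  calc ‖y‖ ≤ ‖x‖ + 2 * c * t * ‖x‖ := h4
    _ ≤ s ^ α * ‖x‖ + 2 * c * t * ‖x‖ := by
        gcongr
        exact le_mul_of_one_le_left (norm_nonneg x) hsα
    _ = _ := by rw [ht]; ring

theorem exists_resolvent_bound_of_decay [CompleteSpace X] (h : IsBoundedSemigroup T c)
    (hA' : ∀ x y, GeneratorRel T x y → Ainv y = x)
    {n : ℕ} (hn : 1 ≤ n) {p M t₁ : ℝ} (hp : 1 ≤ p) (hM : 0 < M) (ht₁ : 0 < t₁)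
    (hdec : ∀ t : ℝ, t₁ ≤ t → ‖T t * Ainv‖ ≤ M * t ^ (-(1 / ((n : ℝ) * p)))) :
    ∃ K > 0, ∀ (lam : ℂ) (x y : X), 0 < lam.re → GeneratorRel T y (lam • y - x) →
      ‖(Ainv ^ n) y‖ ≤ K * ‖x‖ / lam.re ^ (1 - 1 / p) := by
  have hc := h.nonneg
  have hp0 : 0 < p := by linarith
  have hn0 : (0 : ℝ) < n := by exact_mod_cast hn
  obtain ⟨C₁, hC₁, h₁⟩ := h.exists_norm_le_rpow_of_decay hA' (mul_pos hn0 hp0) hM ht₁ hdec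
  obtain ⟨C₂, hC₂, h₂⟩ := exists_norm_pow_apply_le Ainv n
  set θ := 1 - 1 / p with hθ
  have hθ0 : 0 ≤ θ := by
    have : 1 / p ≤ 1 := (div_le_one hp0).2 hp
    linarith
  have hθ1 : θ ≤ 1 := by
    have : 0 ≤ 1 / p := by positivity
    linarith
  set C₃ := C₁ ^ (1 / p) * c ^ θ with hC₃
  have hC₃0 : 0 ≤ C₃ := by positivity
  refine ⟨(1 + ‖Ainv ^ n‖) * (2 ^ n * C₃) + C₂ + 1, by positivity, fun lam x y hlam hy => ?_⟩
  set r := lam.re ^ θ with hr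
  have hr0 : 0 < r := by positivity
  have hy' : ‖y‖ ≤ C₃ * (1 + ‖lam‖) ^ n * ‖x‖ / r := by
    have e1 := h₁ lam x y hlam hy
    have e2 := h.norm_le_div_re hlam hy (sub_sub_cancel _ _)
    calc ‖y‖ = ‖y‖ ^ (1 / p) * ‖y‖ ^ θ := by
          rw [← Real.rpow_add_of_nonneg (norm_nonneg y) (by positivity) hθ0, hθ,
            add_sub_cancel, Real.rpow_one]
      _ ≤ (C₁ * (1 + ‖lam‖) ^ ((n : ℝ) * p) * ‖x‖) ^ (1 / p) * (c * ‖x‖ / lam.re) ^ θ := by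
          gcongr
      _ = C₃ * (1 + ‖lam‖) ^ n * (‖x‖ ^ (1 / p) * ‖x‖ ^ θ) / r := by
          rw [Real.mul_rpow (by positivity) (by positivity), Real.mul_rpow hC₁ (by positivity),
            ← Real.rpow_mul (by positivity), show (n : ℝ) * p * (1 / p) = n by field_simp,
            Real.rpow_natCast, Real.div_rpow (by positivity) hlam.le,
            Real.mul_rpow hc (norm_nonneg x)]
          ring
      _ = C₃ * (1 + ‖lam‖) ^ n * ‖x‖ / r := by
          rw [← Real.rpow_add_of_nonneg (norm_nonneg x) (by positivity) hθ0, hθ,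
            add_sub_cancel, Real.rpow_one]
  rcases le_total ‖lam‖ 1 with hl | hl
  · have e1 : (1 + ‖lam‖) ^ n ≤ 2 ^ n := by
      gcongr
      linarith
    calc ‖(Ainv ^ n) y‖ ≤ ‖Ainv ^ n‖ * ‖y‖ := (Ainv ^ n).le_opNorm y
      _ ≤ ‖Ainv ^ n‖ * (C₃ * 2 ^ n * ‖x‖ / r) := by
          gcongr
          exact hy'.trans (by gcongr)
      _ = ‖Ainv ^ n‖ * (2 ^ n * C₃) * ‖x‖ / r := by ring
      _ ≤ _ := by
          gcongr
          have : 0 ≤ 2 ^ n * C₃ := by positivity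
          linarith
  · have hpos : 0 < ‖lam‖ := by linarith
    have e1 : (1 + ‖lam‖) ^ n ≤ 2 ^ n * ‖lam‖ ^ n := by
      rw [← mul_pow]
      gcongr
      linarith
    have e2 : ‖lam‖⁻¹ ≤ r⁻¹ := by
      gcongr
      calc r ≤ ‖lam‖ ^ θ := by
            rw [hr]
            gcongr
            exact Complex.re_le_norm lam
        _ ≤ ‖lam‖ ^ (1 : ℝ) := Real.rpow_le_rpow_of_exponent_le hl hθ1
        _ = _ := Real.rpow_one _
    calc ‖(Ainv ^ n) y‖ ≤ (‖lam‖ ^ n)⁻¹ * ‖y‖ + C₂ * ‖lam‖⁻¹ * ‖x‖ := h₂ lam x y hl (hA' _ _ hy)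
      _ ≤ (‖lam‖ ^ n)⁻¹ * (C₃ * (2 ^ n * ‖lam‖ ^ n) * ‖x‖ / r) + C₂ * r⁻¹ * ‖x‖ := by
          gcongr
          exact hy'.trans (by gcongr)
      _ = (2 ^ n * C₃ + C₂) * ‖x‖ / r := by field_simp
      _ ≤ _ := by
          refine div_le_div_of_nonneg_right
            (mul_le_mul_of_nonneg_right ?_ (norm_nonneg x)) hr0.le
          have : 0 ≤ ‖Ainv ^ n‖ * (2 ^ n * C₃) := by positivity
          linarith

end Banach
end IsBoundedSemigroup

/-- For a bounded C₀-semigroup on a Hilbert space with generator `A`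
(defined via the strong limit) such that `0 ∈ ρ(A)`, polynomial decay
`‖T(t)A⁻¹‖ = O(t^(-1/(np)))` is equivalent to the `p`-Weiss-type resolvent estimate
`‖A⁻ⁿ R(λ,A)x‖ ≤ K ‖x‖ / (Re λ)^(1-1/p)` on the open right half-plane. -/
theorem stmt_1
    {X : Type*} [NormedAddCommGroup X] [InnerProductSpace ℂ X] [CompleteSpace X]
    (T : ℝ → X →L[ℂ] X)
    (hT0 : T 0 = 1)
    (hTsemi : ∀ s t : ℝ, 0 ≤ s → 0 ≤ t → T (s + t) = T s ∘L T t)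
    (hTcont : ∀ x : X, ContinuousOn (fun t : ℝ => T t x) (Set.Ici 0))
    (hTbdd : ∃ c : ℝ, ∀ t : ℝ, 0 ≤ t → ‖T t‖ ≤ c)
    (Dom : Set X) (A : X → X)
    (hgen : ∀ x y, (x ∈ Dom ∧ A x = y) ↔
      Filter.Tendsto (fun t : ℝ => (t : ℂ)⁻¹ • (T t x - x))
        (nhdsWithin 0 (Set.Ioi 0)) (nhds y))
    (Ainv : X →L[ℂ] X)
    (hAinv₁ : ∀ x, Ainv x ∈ Dom ∧ A (Ainv x) = x)
    (hAinv₂ : ∀ x ∈ Dom, Ainv (A x) = x)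
    (R : ℂ → X →L[ℂ] X)
    (hR₁ : ∀ lam : ℂ, 0 < lam.re → ∀ x, R lam x ∈ Dom ∧ lam • R lam x - A (R lam x) = x)
    (hR₂ : ∀ lam : ℂ, 0 < lam.re → ∀ x ∈ Dom, R lam (lam • x - A x) = x)
    (n : ℕ) (hn : 1 ≤ n) (p : ℝ) (hp : 1 ≤ p) :
    (∃ M > 0, ∃ t₁ > 0, ∀ t : ℝ, t₁ ≤ t →
        ‖(T t) ∘L Ainv‖ ≤ M * t ^ (-(1 / ((n : ℝ) * p))))
      ↔ (∃ K > 0, ∀ lam : ℂ, 0 < lam.re → ∀ x : X,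
          ‖(Ainv ^ n) (R lam x)‖ ≤ K * ‖x‖ / lam.re ^ (1 - 1 / p)) := by
  obtain ⟨c, hc⟩ := hTbdd
  have h : IsBoundedSemigroup T c := ⟨hT0, hTsemi, hTcont, hc⟩
  have hA : ∀ x, GeneratorRel T (Ainv x) x := fun x => (hgen _ _).1 (hAinv₁ x)
  have hA' : ∀ x y, GeneratorRel T x y → Ainv y = x := fun x y hxy => by
    obtain ⟨hx, rfl⟩ := (hgen x y).2 hxy
    exact hAinv₂ x hx
  have hR : ∀ lam : ℂ, 0 < lam.re → ∀ x, GeneratorRel T (R lam x) (lam • R lam x - x) :=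
    fun lam hlam x => (hgen _ _).1 ⟨(hR₁ lam hlam x).1,
      (sub_eq_of_eq_add (sub_eq_iff_eq_add'.1 (hR₁ lam hlam x).2)).symm⟩
  constructor
  · rintro ⟨M, hM, t₁, ht₁, hdec⟩
    obtain ⟨K, hK, hb⟩ := h.exists_resolvent_bound_of_decay hA' hn hp hM ht₁ hdec
    exact ⟨K, hK, fun lam hlam x => hb lam x _ hlam (hR lam hlam x)⟩
  · rintro ⟨K, hK, hb⟩
    obtain ⟨M, hM, hdec⟩ := h.exists_decay_of_resolvent_bound hA hA' hR hn hp hK hb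
    exact ⟨M, hM, 1, one_pos, fun t ht => hdec t (by linarith)⟩
end

section
/- Let (T(t))_{t≥0} be a bounded C₀-semigroup on a complex Hilbert space X with generator A such that 0 lies in the resolvent set of A. Then for fixed integers m > n ≥ 1 the following are equivalent: (i) there exists M_m > 0 such that ‖R(λ,A) A^{-m}‖ ≤ M_m for all λ with Re λ > 0; (ii) there exists M > 0 such that ‖R(λ,A) A^{-n}‖ ≤ M / (Re λ)^{1 - n/m} for all λ with Re λ > 0. (Integer-exponent case of the resolvent interpolation corollary.) -/
section Semigroup

variable {X : Type*} [NormedAddCommGroup X] [NormedSpace ℂ X] {T : ℝ → X →L[ℂ] X}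

/-- Orbits of a semigroup starting in the domain of the generator are differentiable
from the right. -/
theorem hasDerivWithinAt_orbit
    (hTsemi : ∀ s t : ℝ, 0 ≤ s → 0 ≤ t → T (s + t) = T s ∘L T t) {y z : X}
    (hy : Filter.Tendsto (fun t : ℝ => (t : ℂ)⁻¹ • (T t y - y))
      (nhdsWithin 0 (Set.Ioi 0)) (nhds z)) {t : ℝ} (ht : 0 ≤ t) :
    HasDerivWithinAt (fun s => T s y) (T t z) (Set.Ici t) t := by
  rw [← hasDerivWithinAt_Ioi_iff_Ici, hasDerivWithinAt_iff_tendsto_slope' (by simp)]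
  have hshift : Filter.Tendsto (fun u : ℝ => u - t) (nhdsWithin t (Set.Ioi t))
      (nhdsWithin 0 (Set.Ioi 0)) := by
    refine tendsto_nhdsWithin_iff.2 ⟨?_, ?_⟩
    · have : Filter.Tendsto (fun u : ℝ => u - t) (nhds t) (nhds (t - t)) :=
        (continuous_id.sub continuous_const).tendsto t
      rw [sub_self] at this
      exact this.mono_left nhdsWithin_le_nhds
    · filter_upwards [self_mem_nhdsWithin] with u hu
      exact sub_pos.2 (Set.mem_Ioi.1 hu)
  refine (((T t).continuous.tendsto z).comp (hy.comp hshift)).congr' ?_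
  filter_upwards [self_mem_nhdsWithin] with u hu
  have hu' : 0 ≤ u - t := (sub_pos.2 (Set.mem_Ioi.1 hu)).le
  have h : T u y = T t (T (u - t) y) := by
    rw [← ContinuousLinearMap.comp_apply, ← hTsemi t (u - t) ht hu', add_sub_cancel]
  simp only [Function.comp_apply, slope_def_module, map_smul, map_sub, h]
  rw [← Complex.ofReal_inv, Complex.coe_smul]

/-- The Hille–Yosida resolvent estimate for a bounded semigroup. -/
theorem norm_le_of_resolvent_eq
    (hT0 : T 0 = 1)
    (hTsemi : ∀ s t : ℝ, 0 ≤ s → 0 ≤ t → T (s + t) = T s ∘L T t)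
    (hTcont : ∀ x : X, ContinuousOn (fun t : ℝ => T t x) (Set.Ici 0))
    {c : ℝ} (hc : ∀ t : ℝ, 0 ≤ t → ‖T t‖ ≤ c) {lam : ℂ} (hlam : 0 < lam.re) {x y z : X}
    (hy : Filter.Tendsto (fun t : ℝ => (t : ℂ)⁻¹ • (T t y - y))
      (nhdsWithin 0 (Set.Ioi 0)) (nhds z)) (hx : lam • y - z = x) :
    ‖y‖ ≤ c / lam.re * ‖x‖ := by
  have hc0 : 0 ≤ c := (norm_nonneg _).trans (hc 0 le_rfl)
  have hexp (t : ℝ) : ‖Complex.exp (-lam * t)‖ = Real.exp (-lam.re * t) := by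
    simp [Complex.norm_exp]
  have hE (t : ℝ) : HasDerivAt (fun s : ℝ => Complex.exp (-lam * s))
      (Complex.exp (-lam * t) * -lam) t := by
    simpa using (((hasDerivAt_id (t : ℂ)).const_mul (-lam)).cexp).comp_ofReal
  have hderiv (t : ℝ) (ht : 0 ≤ t) :
      HasDerivWithinAt (fun s : ℝ => y - Complex.exp (-lam * s) • T s y)
        (Complex.exp (-lam * t) • T t x) (Set.Ici t) t := by
    have h := ((hE t).hasDerivWithinAt.smul (hasDerivWithinAt_orbit hTsemi hy ht)).const_sub y
    refine h.congr_deriv ?_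
    rw [← hx, map_sub, map_smul]
    module
  have hbound (t : ℝ) (ht : 0 ≤ t) :
      ‖y - Complex.exp (-lam * t) • T t y‖ ≤
        c * ‖x‖ / lam.re * (1 - Real.exp (-lam.re * t)) := by
    refine image_norm_le_of_norm_deriv_right_le_deriv_boundary (a := 0) (b := t)
      (f := fun s : ℝ => y - Complex.exp (-lam * s) • T s y)
      (f' := fun s : ℝ => Complex.exp (-lam * s) • T s x)
      (B := fun s => c * ‖x‖ / lam.re * (1 - Real.exp (-lam.re * s)))
      (B' := fun s => c * ‖x‖ * Real.exp (-lam.re * s)) ?_ ?_ ?_ ?_ ?_ ⟨ht, le_rfl⟩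
    · refine continuousOn_const.sub (ContinuousOn.smul (by fun_prop) ?_)
      exact (hTcont y).mono fun s hs => hs.1
    · exact fun s hs => hderiv s hs.1
    · simp [hT0]
    · intro s
      have h := ((((hasDerivAt_id s).const_mul (-lam.re)).exp).const_sub 1).const_mul
        (c * ‖x‖ / lam.re)
      refine h.congr_deriv ?_
      simp only [id]
      field_simp
    · intro s hs
      rw [norm_smul, hexp, mul_comm]
      gcongr
      exact (T s).le_of_opNorm_le (hc s hs.1) x
  have hlim : Filter.Tendsto
      (fun t : ℝ => c / lam.re * ‖x‖ + Real.exp (-lam.re * t) * (c * ‖y‖)) Filter.atTop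
      (nhds (c / lam.re * ‖x‖ + 0 * (c * ‖y‖))) := by
    refine tendsto_const_nhds.add (Filter.Tendsto.mul_const _ ?_)
    refine Real.tendsto_exp_atBot.comp ?_
    exact Filter.tendsto_id.const_mul_atTop_of_neg (by linarith)
  rw [zero_mul, add_zero] at hlim
  refine ge_of_tendsto hlim ?_
  filter_upwards [Filter.eventually_ge_atTop 0] with t ht
  calc ‖y‖ = ‖(y - Complex.exp (-lam * t) • T t y) + Complex.exp (-lam * t) • T t y‖ := by
        rw [sub_add_cancel]
    _ ≤ c * ‖x‖ / lam.re * (1 - Real.exp (-lam.re * t)) +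
        Real.exp (-lam.re * t) * (c * ‖y‖) := by
      refine (norm_add_le _ _).trans (add_le_add (hbound t ht) ?_)
      rw [norm_smul, hexp]
      gcongr
      exact (T t).le_of_opNorm_le (hc t ht) y
    _ ≤ c / lam.re * ‖x‖ + Real.exp (-lam.re * t) * (c * ‖y‖) := by
      rw [div_mul_eq_mul_div c lam.re ‖x‖]
      refine add_le_add ?_ le_rfl
      refine mul_le_of_le_one_right (by positivity) ?_
      linarith [Real.exp_pos (-lam.re * t)]

end Semigroup

section Interpolation

variable {𝔸 : Type*} [NormedRing 𝔸]

theorem norm_pow_mul_le_pow_mul {Q : 𝔸} {K : ℝ} (hQ : ‖Q‖ ≤ K) (k : ℕ) (Z : 𝔸) :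
    ‖Q ^ k * Z‖ ≤ K ^ k * ‖Z‖ := by
  induction k with
  | zero => simp
  | succ k ih =>
    rw [pow_succ', pow_succ', mul_assoc, mul_assoc]
    have hK : 0 ≤ K := (norm_nonneg _).trans hQ
    exact (norm_mul_le _ _).trans (by gcongr)

/-- If `Q` is an inverse of `1 - C`, then the intermediate powers of `C` are controlled by
the extreme ones, with a constant depending only on the size of `Q`. -/
theorem norm_pow_mul_le_of_mul_eq_sub_one {Q C : 𝔸} {K : ℝ} (hQC : Q * C = Q - 1)
    (hCQ : C * Q = Q - 1) (hQ : ‖Q‖ ≤ K) (hQ1 : ‖Q - 1‖ ≤ K) {m n : ℕ} (hnm : n ≤ m)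
    (Z : 𝔸) : ‖C ^ n * Z‖ ≤ 2 ^ m * K ^ m * (‖C ^ m * Z‖ + ‖Z‖) := by
  have hcomm : Commute Q C := hQC.trans hCQ.symm
  have hK : 0 ≤ K := (norm_nonneg _).trans hQ
  have hlow (j : ℕ) (hj : j ≤ m) (W : 𝔸) : ‖Q ^ m * C ^ j * W‖ ≤ K ^ m * ‖W‖ := by
    have h : Q ^ m * C ^ j = Q ^ (m - j) * (Q - 1) ^ j := by
      rw [← hQC, hcomm.mul_pow, ← mul_assoc, ← pow_add, Nat.sub_add_cancel hj]
    rw [h, mul_assoc]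
    refine (norm_pow_mul_le_pow_mul hQ _ _).trans ?_
    refine (mul_le_mul_of_nonneg_left (norm_pow_mul_le_pow_mul hQ1 _ _) (by positivity)).trans ?_
    rw [← mul_assoc, ← pow_add, Nat.sub_add_cancel hj]
  have hbase (j : ℕ) (hj : j ≤ 2 * m) :
      ‖Q ^ m * C ^ j * Z‖ ≤ K ^ m * (‖C ^ m * Z‖ + ‖Z‖) := by
    rcases le_total j m with hjm | hjm
    · refine (hlow j hjm Z).trans ?_
      gcongr
      exact le_add_of_nonneg_left (norm_nonneg _)
    · have h : Q ^ m * C ^ j * Z = Q ^ m * C ^ (j - m) * (C ^ m * Z) := by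
        rw [← mul_assoc, mul_assoc (Q ^ m) (C ^ (j - m)), ← pow_add, Nat.sub_add_cancel hjm]
      rw [h]
      refine (hlow (j - m) (by omega) _).trans ?_
      gcongr
      exact le_add_of_nonneg_right (norm_nonneg _)
  have hstep (k : ℕ) : ∀ j, j + k ≤ 2 * m →
      ‖Q ^ m * C ^ j * (1 - C) ^ k * Z‖ ≤ 2 ^ k * (K ^ m * (‖C ^ m * Z‖ + ‖Z‖)) := by
    induction k with
    | zero => intro j hj; simpa using hbase j hj
    | succ k ih =>
      intro j hj
      have h : Q ^ m * C ^ j * (1 - C) ^ (k + 1) * Z =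
          Q ^ m * C ^ j * (1 - C) ^ k * Z - Q ^ m * C ^ (j + 1) * (1 - C) ^ k * Z := by
        rw [pow_succ', pow_succ]
        noncomm_ring
      rw [h]
      refine (norm_sub_le _ _).trans ?_
      rw [pow_succ' (2 : ℝ), mul_assoc (2 : ℝ), two_mul]
      exact add_le_add (ih j (by omega)) (ih (j + 1) (by omega))
  have hone : Q * (1 - C) = 1 := by rw [mul_sub, mul_one, hQC, sub_sub_cancel]
  have hcomm' : Commute Q (1 - C) := (Commute.one_right Q).sub_right hcomm
  have h : C ^ n * Z = Q ^ m * C ^ n * (1 - C) ^ m * Z := by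
    have h1 : Commute (Q ^ m) (C ^ n) := hcomm.pow_pow m n
    rw [h1.eq, mul_assoc (C ^ n), ← hcomm'.mul_pow, hone, one_pow, mul_one]
  rw [h, mul_assoc (2 ^ m)]
  exact hstep m n (by omega)

end Interpolation

section Resolvent

variable {𝔸 : Type*} [NormedRing 𝔸] [NormedAlgebra ℂ 𝔸]

/-- Upper bound for `R` in terms of `R * B ^ k`, away from the origin. -/
theorem exists_norm_le_pow_mul_of_smul_mul_eq (B : 𝔸) {δ : ℝ} (hδ : 0 < δ) (k : ℕ) :
    ∃ C : ℝ, 0 ≤ C ∧ ∀ (lam : ℂ) (R : 𝔸), δ ≤ ‖lam‖ → lam • (R * B) = R + B →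
      ‖R‖ ≤ ‖lam‖ ^ k * (‖R * B ^ k‖ + C) := by
  induction k with
  | zero => exact ⟨0, le_rfl, fun lam R _ _ => by simp⟩
  | succ k ih =>
    obtain ⟨C, hC, h⟩ := ih
    refine ⟨(‖B ^ (k + 1)‖ + C) / δ, by positivity, fun lam R hlam hR => ?_⟩
    have hid : R * B ^ k = lam • (R * B ^ (k + 1)) - B ^ (k + 1) := by
      rw [pow_succ', ← mul_assoc, ← smul_mul_assoc, hR, add_mul, add_sub_cancel_right]
    have h2 : ‖R * B ^ k‖ ≤ ‖lam‖ * ‖R * B ^ (k + 1)‖ + ‖B ^ (k + 1)‖ := by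
      rw [hid]
      exact (norm_sub_le _ _).trans (by rw [norm_smul])
    have h3 : ‖B ^ (k + 1)‖ + C ≤ ‖lam‖ * ((‖B ^ (k + 1)‖ + C) / δ) := by
      rw [mul_div_assoc', le_div_iff₀ hδ, mul_comm]
      gcongr
    calc ‖R‖ ≤ ‖lam‖ ^ k * (‖R * B ^ k‖ + C) := h lam R hlam hR
      _ ≤ ‖lam‖ ^ k * (‖lam‖ * (‖R * B ^ (k + 1)‖ + (‖B ^ (k + 1)‖ + C) / δ)) := by
        gcongr
        linarith
      _ = _ := by rw [← mul_assoc, ← pow_succ]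

/-- Upper bound for `R * B ^ k` in terms of `R`, away from the origin. -/
theorem exists_norm_mul_pow_le_of_smul_mul_eq (B : 𝔸) {δ : ℝ} (hδ : 0 < δ) (k : ℕ) :
    ∃ C : ℝ, 0 ≤ C ∧ ∀ (lam : ℂ) (R : 𝔸), δ ≤ ‖lam‖ → lam • (R * B) = R + B →
      ‖R * B ^ k‖ ≤ ‖R‖ / ‖lam‖ ^ k + C := by
  induction k with
  | zero => exact ⟨0, le_rfl, fun lam R _ _ => by simp⟩
  | succ k ih =>
    obtain ⟨C, hC, h⟩ := ih
    refine ⟨(C + ‖B ^ (k + 1)‖) / δ, by positivity, fun lam R hlam hR => ?_⟩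
    have hpos : 0 < ‖lam‖ := hδ.trans_le hlam
    have hid : lam • (R * B ^ (k + 1)) = R * B ^ k + B ^ (k + 1) := by
      rw [pow_succ', ← mul_assoc, ← smul_mul_assoc, hR, add_mul]
    have h2 : ‖lam‖ * ‖R * B ^ (k + 1)‖ ≤ ‖R‖ / ‖lam‖ ^ k + C + ‖B ^ (k + 1)‖ := by
      rw [← norm_smul, hid]
      exact (norm_add_le _ _).trans (by gcongr; exact h lam R hlam hR)
    calc ‖R * B ^ (k + 1)‖ ≤ (‖R‖ / ‖lam‖ ^ k + C + ‖B ^ (k + 1)‖) / ‖lam‖ := by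
          rwa [le_div_iff₀' hpos]
      _ = ‖R‖ / ‖lam‖ ^ (k + 1) + (C + ‖B ^ (k + 1)‖) / ‖lam‖ := by
        rw [add_assoc, add_div, div_div, ← pow_succ]
      _ ≤ _ := by gcongr

variable {B : 𝔸} {R : ℂ → 𝔸} {c : ℝ} {m n : ℕ}

theorem norm_mul_pow_le_div_rpow
    (hRB : ∀ lam : ℂ, 0 < lam.re → lam • (R lam * B) = R lam + B)
    (hBR : ∀ lam : ℂ, 0 < lam.re → lam • (B * R lam) = R lam + B)
    (hc : ∀ lam : ℂ, 0 < lam.re → ‖R lam‖ ≤ c / lam.re) (hnm : n < m)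
    {M : ℝ} (hM : 0 < M) (h : ∀ lam : ℂ, 0 < lam.re → ‖R lam * B ^ m‖ ≤ M) :
    ∃ M' > 0, ∀ lam : ℂ, 0 < lam.re →
      ‖R lam * B ^ n‖ ≤ M' / lam.re ^ (1 - (n : ℝ) / (m : ℝ)) := by
  have hc0 : 0 ≤ c := by simpa using (norm_nonneg _).trans (hc 1 (by simp))
  have hcomm (lam : ℂ) (hlam : 0 < lam.re) : Commute (R lam) B := by
    have hne : lam ≠ 0 := by rintro rfl; simp at hlam
    exact smul_right_injective 𝔸 hne ((hRB lam hlam).trans (hBR lam hlam).symm)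
  set K : ℝ := ‖(1 : 𝔸)‖ + c + 1 with hK
  have hKpos : 0 < K := by positivity
  refine ⟨2 ^ m * K ^ m * (M + c), by positivity, fun lam hlam => ?_⟩
  set a := lam.re with ha
  set s : ℝ := a ^ (-(1 / (m : ℝ))) with hs
  have hspos : 0 < s := by positivity
  have hm : (m : ℝ) ≠ 0 := by exact_mod_cast (show m ≠ 0 by omega)
  have hsm : s ^ m = 1 / a := by
    rw [hs, ← Real.rpow_natCast, ← Real.rpow_mul hlam.le,
      show -(1 / (m : ℝ)) * m = -1 by field_simp, Real.rpow_neg_one, one_div]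
  have hsn : s ^ n = 1 / a ^ ((n : ℝ) / m) := by
    rw [hs, ← Real.rpow_natCast, ← Real.rpow_mul hlam.le,
      show -(1 / (m : ℝ)) * n = -((n : ℝ) / m) by ring, Real.rpow_neg hlam.le, one_div]
  have hsre : 0 < (s : ℂ).re := by simpa using hspos
  have hsR : ‖(s : ℂ) • R s‖ ≤ c := by
    have h1 := hc s hsre
    rw [Complex.ofReal_re, le_div_iff₀ hspos] at h1
    rw [norm_smul, Complex.norm_real, Real.norm_of_nonneg hspos.le, mul_comm]
    exact h1
  have key := norm_pow_mul_le_of_mul_eq_sub_one (Q := 1 - (s : ℂ) • R s) (C := (s : ℂ) • B)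
    (K := K)
    (by rw [sub_mul, smul_mul_smul_comm, mul_smul, hRB s hsre, one_mul, smul_add]; abel)
    (by rw [mul_sub, smul_mul_smul_comm, mul_smul, hBR s hsre, mul_one, smul_add]; abel)
    ((norm_sub_le _ _).trans (by linarith))
    (by rw [sub_sub_cancel_left, norm_neg]; linarith [norm_nonneg (1 : 𝔸)])
    hnm.le (R lam)
  have hpow (k : ℕ) : ‖((s : ℂ) • B) ^ k * R lam‖ = s ^ k * ‖R lam * B ^ k‖ := by
    rw [smul_pow, smul_mul_assoc, norm_smul, ((hcomm lam hlam).pow_right k).eq, norm_pow,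
      Complex.norm_real, Real.norm_of_nonneg hspos.le]
  rw [hpow, hpow, hsm, hsn] at key
  have key2 : 1 / a ^ ((n : ℝ) / m) * ‖R lam * B ^ n‖ ≤ 2 ^ m * K ^ m * (1 / a * M + c / a) := by
    refine key.trans ?_
    gcongr
    · exact h lam hlam
    · exact hc lam hlam
  have hpos : 0 < a ^ ((n : ℝ) / m) := by positivity
  rw [Real.rpow_sub hlam, Real.rpow_one]
  calc ‖R lam * B ^ n‖
      = a ^ ((n : ℝ) / m) * (1 / a ^ ((n : ℝ) / m) * ‖R lam * B ^ n‖) := by field_simp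
    _ ≤ a ^ ((n : ℝ) / m) * (2 ^ m * K ^ m * (1 / a * M + c / a)) := by gcongr
    _ = _ := by field_simp

theorem norm_mul_pow_le_of_le_div_rpow
    (hRB : ∀ lam : ℂ, 0 < lam.re → lam • (R lam * B) = R lam + B)
    (hres : ∀ lam mu : ℂ, 0 < lam.re → 0 < mu.re →
      R lam + (lam - mu) • (R lam * R mu) = R mu)
    (hc : ∀ lam : ℂ, 0 < lam.re → ‖R lam‖ ≤ c / lam.re) (hn : 1 ≤ n) (hnm : n < m)
    {M : ℝ} (hM : 0 < M)
    (h : ∀ lam : ℂ, 0 < lam.re → ‖R lam * B ^ n‖ ≤ M / lam.re ^ (1 - (n : ℝ) / (m : ℝ))) :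
    ∃ M' > 0, ∀ lam : ℂ, 0 < lam.re → ‖R lam * B ^ m‖ ≤ M' := by
  have hc0 : 0 ≤ c := by simpa using (norm_nonneg _).trans (hc 1 (by simp))
  have hm0 : (m : ℝ) ≠ 0 := by exact_mod_cast (show m ≠ 0 by omega)
  set δ : ℝ := 1 / (2 * ‖B‖ + 1) with hδ
  have hδpos : 0 < δ := by positivity
  have hδ1 : δ ≤ 1 := by
    rw [hδ, div_le_one (by positivity)]; linarith [norm_nonneg B]
  obtain ⟨C, hC, hlower⟩ := exists_norm_le_pow_mul_of_smul_mul_eq B hδpos n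
  obtain ⟨D, hD, hupper⟩ := exists_norm_mul_pow_le_of_smul_mul_eq B hδpos m
  set L : ℝ := 1 + 1 / δ with hL
  have hLpos : 0 < L := by positivity
  set η : ℝ := min δ (1 / (2 * (L ^ n * (M + C)))) with hη
  have hηpos : 0 < η := by positivity
  have hηδ : η ≤ δ := min_le_left _ _
  have hηL : L ^ n * (M + C) * η ≤ 1 / 2 := by
    have h1 : η ≤ 1 / (2 * (L ^ n * (M + C))) := min_le_right _ _
    rw [le_div_iff₀ (by positivity)] at h1
    linarith
  have hfar (lam : ℂ) (hlam : 0 < lam.re) (hr : δ ≤ ‖lam‖) :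
      ‖R lam‖ ≤ (c + 1) * (‖lam‖ / η) ^ m := by
    set r := ‖lam‖ with hrdef
    have hrpos : 0 < r := hδpos.trans_le hr
    have hηr : η / r ≤ 1 := (div_le_one hrpos).2 (hηδ.trans hr)
    set a : ℝ := (η / r) ^ m with ha
    have hapos : 0 < a := by positivity
    have hainv : (r / η) ^ m = 1 / a := by rw [ha, one_div, ← inv_pow, inv_div]
    have ha1 : a ≤ 1 := pow_le_one₀ (by positivity) hηr
    rw [hainv]
    rcases le_or_gt a lam.re with hle | hlt
    · refine (hc lam hlam).trans ?_
      rw [mul_one_div]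
      gcongr
      linarith
    · set mu : ℂ := ⟨a, lam.im⟩ with hmu
      have hmure : 0 < mu.re := hapos
      have hsub : mu - lam = ((a - lam.re : ℝ) : ℂ) := by
        apply Complex.ext <;> simp [hmu]
      have hnsub : ‖mu - lam‖ ≤ a := by
        rw [hsub, Complex.norm_real, Real.norm_of_nonneg (by linarith)]
        linarith
      have hmule : ‖mu‖ ≤ L * r := by
        have h1 : 1 ≤ 1 / δ * r := by rw [one_div_mul_eq_div, one_le_div hδpos]; exact hr
        calc ‖mu‖ = ‖lam + (mu - lam)‖ := by rw [add_sub_cancel]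
          _ ≤ r + a := (norm_add_le _ _).trans (by gcongr)
          _ ≤ L * r := by rw [hL, add_mul]; linarith
      have hmuge : δ ≤ ‖mu‖ := by
        refine hr.trans ?_
        rw [hrdef, Complex.norm_def, Complex.norm_def]
        refine Real.sqrt_le_sqrt ?_
        simp only [Complex.normSq_apply, hmu]
        nlinarith
      have hrpow : a ^ (1 - (n : ℝ) / m) = (η / r) ^ (m - n) := by
        rw [ha, ← Real.rpow_natCast, ← Real.rpow_mul (by positivity),
          ← Real.rpow_natCast (η / r), Nat.cast_sub hnm.le]
        congr 1
        field_simp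
      have hsmall : a * ‖R mu‖ ≤ 1 / 2 := by
        have h1 : ‖R mu‖ ≤ (L * r) ^ n * (M / (η / r) ^ (m - n) + C) := by
          refine (hlower mu (R mu) hmuge (hRB mu hmure)).trans ?_
          gcongr
          rw [← hrpow]
          exact h mu hmure
        have h2 : a = (η / r) ^ n * (η / r) ^ (m - n) := by
          rw [ha, ← pow_add, Nat.add_sub_cancel' hnm.le]
        have hq : (η / r) ^ (m - n) ≤ 1 := pow_le_one₀ (by positivity) hηr
        calc a * ‖R mu‖ ≤ a * ((L * r) ^ n * (M / (η / r) ^ (m - n) + C)) := by gcongr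
          _ = L ^ n * (M + C * (η / r) ^ (m - n)) * η ^ n := by
            rw [h2, mul_pow, div_pow η r n]
            have : (η / r) ^ (m - n) ≠ 0 := by positivity
            generalize (η / r) ^ (m - n) = q at this
            field_simp
          _ ≤ L ^ n * (M + C * 1) * η := by
            gcongr
            exact pow_le_of_le_one hηpos.le (hηδ.trans hδ1) (by omega)
          _ ≤ 1 / 2 := by rwa [mul_one]
      have h3 : ‖R lam‖ ≤ ‖R mu‖ + a * ‖R mu‖ * ‖R lam‖ := by
        have h4 := hres mu lam hmure hlam
        calc ‖R lam‖ = ‖R mu + (mu - lam) • (R mu * R lam)‖ := by rw [h4]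
          _ ≤ ‖R mu‖ + ‖mu - lam‖ * (‖R mu‖ * ‖R lam‖) := by
            refine (norm_add_le _ _).trans ?_
            rw [norm_smul]
            gcongr
            exact norm_mul_le _ _
          _ ≤ ‖R mu‖ + a * (‖R mu‖ * ‖R lam‖) := by gcongr
          _ = _ := by ring
      have h5 : a * ‖R mu‖ * ‖R lam‖ ≤ 1 / 2 * ‖R lam‖ := by gcongr
      rw [mul_one_div, le_div_iff₀ hapos]
      nlinarith
  refine ⟨(c + 1) / η ^ m + D + 2 * ‖B‖ * ‖B ^ m‖, by positivity, fun lam hlam => ?_⟩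
  rcases le_or_gt δ ‖lam‖ with hr | hr
  · have hrpos : 0 < ‖lam‖ := hδpos.trans_le hr
    have h1 : ‖R lam‖ / ‖lam‖ ^ m ≤ (c + 1) / η ^ m := by
      rw [div_le_iff₀ (by positivity)]
      refine (hfar lam hlam hr).trans (le_of_eq ?_)
      rw [div_pow]
      ring
    have h2 : 0 ≤ 2 * ‖B‖ * ‖B ^ m‖ := by positivity
    linarith [hupper lam (R lam) hr (hRB lam hlam)]
  · have h1 : ‖R lam‖ ≤ 2 * ‖B‖ := by
      have h2 : ‖R lam‖ ≤ ‖lam‖ * (‖R lam‖ * ‖B‖) + ‖B‖ := by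
        calc ‖R lam‖ = ‖lam • (R lam * B) - B‖ := by rw [hRB lam hlam, add_sub_cancel_right]
          _ ≤ _ := by
            refine (norm_sub_le _ _).trans ?_
            rw [norm_smul]
            gcongr
            exact norm_mul_le _ _
      have h3 : ‖lam‖ * ‖B‖ ≤ 1 / 2 := by
        have h4 : δ * (2 * ‖B‖ + 1) = 1 := by rw [hδ]; field_simp
        nlinarith [norm_nonneg B]
      nlinarith [norm_nonneg (R lam)]
    calc ‖R lam * B ^ m‖ ≤ ‖R lam‖ * ‖B ^ m‖ := norm_mul_le _ _
      _ ≤ 2 * ‖B‖ * ‖B ^ m‖ := by gcongr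
      _ ≤ _ := le_add_of_nonneg_left (by positivity)

end Resolvent


/-- Resolvent interpolation for a bounded C₀-semigroup on a Hilbert space
with generator `A` and `0 ∈ ρ(A)`: uniform boundedness of `R(λ,A)A^{-m}` on the right
half-plane is equivalent to the growth bound `‖R(λ,A)A^{-n}‖ ≤ M/(Re λ)^(1-n/m)`,
for integers `m > n ≥ 1`. -/
theorem stmt_2
    {X : Type*} [NormedAddCommGroup X] [InnerProductSpace ℂ X] [CompleteSpace X]
    (T : ℝ → X →L[ℂ] X)
    (hT0 : T 0 = 1)
    (hTsemi : ∀ s t : ℝ, 0 ≤ s → 0 ≤ t → T (s + t) = T s ∘L T t)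
    (hTcont : ∀ x : X, ContinuousOn (fun t : ℝ => T t x) (Set.Ici 0))
    (hTbdd : ∃ c : ℝ, ∀ t : ℝ, 0 ≤ t → ‖T t‖ ≤ c)
    (Dom : Set X) (A : X → X)
    (hgen : ∀ x y, (x ∈ Dom ∧ A x = y) ↔
      Filter.Tendsto (fun t : ℝ => (t : ℂ)⁻¹ • (T t x - x))
        (nhdsWithin 0 (Set.Ioi 0)) (nhds y))
    (Ainv : X →L[ℂ] X)
    (hAinv₁ : ∀ x, Ainv x ∈ Dom ∧ A (Ainv x) = x)
    (hAinv₂ : ∀ x ∈ Dom, Ainv (A x) = x)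
    (R : ℂ → X →L[ℂ] X)
    (hR₁ : ∀ lam : ℂ, 0 < lam.re → ∀ x, R lam x ∈ Dom ∧ lam • R lam x - A (R lam x) = x)
    (hR₂ : ∀ lam : ℂ, 0 < lam.re → ∀ x ∈ Dom, R lam (lam • x - A x) = x)
    (m n : ℕ) (hn : 1 ≤ n) (hnm : n < m) :
    (∃ Mm > 0, ∀ lam : ℂ, 0 < lam.re → ‖(R lam) ∘L (Ainv ^ m)‖ ≤ Mm)
      ↔ (∃ M > 0, ∀ lam : ℂ, 0 < lam.re →
          ‖(R lam) ∘L (Ainv ^ n)‖ ≤ M / lam.re ^ (1 - (n : ℝ) / (m : ℝ))) := by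
  obtain ⟨c, hc⟩ := hTbdd
  have hc0 : 0 ≤ c := (norm_nonneg _).trans (hc 0 le_rfl)
  have hRB (lam : ℂ) (hlam : 0 < lam.re) : lam • (R lam * Ainv) = R lam + Ainv := by
    ext x
    have h := hR₂ lam hlam (Ainv x) (hAinv₁ x).1
    rw [(hAinv₁ x).2, map_sub, map_smul, sub_eq_iff_eq_add'] at h
    simpa using h
  have hBR (lam : ℂ) (hlam : 0 < lam.re) : lam • (Ainv * R lam) = R lam + Ainv := by
    ext x
    obtain ⟨h1, h2⟩ := hR₁ lam hlam x
    have h3 := congrArg Ainv h2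
    rw [map_sub, map_smul, hAinv₂ _ h1, sub_eq_iff_eq_add'] at h3
    simpa using h3
  have hres (lam mu : ℂ) (hlam : 0 < lam.re) (hmu : 0 < mu.re) :
      R lam + (lam - mu) • (R lam * R mu) = R mu := by
    ext x
    obtain ⟨h1, h2⟩ := hR₁ mu hmu x
    have h3 := hR₂ lam hlam _ h1
    have h4 : lam • R mu x - A (R mu x) = x + (lam - mu) • R mu x := by
      nth_rewrite 3 [← h2]
      module
    rw [h4, map_add, map_smul] at h3
    simpa using h3
  have hRc (lam : ℂ) (hlam : 0 < lam.re) : ‖R lam‖ ≤ c / lam.re := by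
    refine ContinuousLinearMap.opNorm_le_bound _ (by positivity) fun x => ?_
    obtain ⟨h1, h2⟩ := hR₁ lam hlam x
    exact norm_le_of_resolvent_eq hT0 hTsemi hTcont hc hlam ((hgen _ _).1 ⟨h1, rfl⟩) h2
  exact ⟨fun ⟨_, hM, h⟩ => norm_mul_pow_le_div_rpow hRB hBR hRc hnm hM h,
    fun ⟨_, hM, h⟩ => norm_mul_pow_le_of_le_div_rpow hRB hres hRc hn hnm hM h⟩
end

section
/- Let X and Y be complex Banach spaces, let (T(t))_{t≥0} be a bounded C₀-semigroup on X with generator A, and let C : D(A) → Y be a linear map for which there exists c > 0 with ‖Cx‖ ≤ c(‖x‖ + ‖Ax‖) for all x ∈ D(A). Assume that for every t > 0 there is a bounded linear operator S(t) : X → Y with S(t)x = C T(t) x for all x ∈ D(A), and that there exist M > 0 and p with 1 < p ≤ ∞ such that ‖S(t)‖ ≤ M / t^{1/p} for all t > 0 (with 1/p := 0 when p = ∞). Then C satisfies the p-Weiss condition for A: there exists K > 0 such that ‖C R(λ,A) x‖ ≤ K ‖x‖ / (Re λ)^{1-1/p} for all λ with Re λ > 0 and all x ∈ X. -/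
open scoped ENNReal

/-- If `F` is continuous on `[a, b]` and the norm of its right derivative is at most the right
derivative of `B`, then `‖F b - F a‖ ≤ B b - B a`. -/
theorem norm_sub_le_of_norm_deriv_right_le {E : Type*} [NormedAddCommGroup E] [NormedSpace ℝ E]
    {F F' : ℝ → E} {B B' : ℝ → ℝ} {a b : ℝ} (hab : a ≤ b)
    (hF : ContinuousOn F (Set.Icc a b))
    (hF' : ∀ t ∈ Set.Ico a b, HasDerivWithinAt F (F' t) (Set.Ici t) t)
    (hB : ContinuousOn B (Set.Icc a b))
    (hB' : ∀ t ∈ Set.Ico a b, HasDerivWithinAt B (B' t) (Set.Ici t) t)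
    (bound : ∀ t ∈ Set.Ico a b, ‖F' t‖ ≤ B' t) :
    ‖F b - F a‖ ≤ B b - B a :=
  image_norm_le_of_norm_deriv_right_le_deriv_boundary'
    (f := fun t => F t - F a) (f' := F') (B := fun t => B t - B a) (B' := B')
    (hF.sub continuousOn_const) (fun t ht => (hF' t ht).sub_const _) (by simp)
    (hB.sub continuousOn_const) (fun t ht => (hB' t ht).sub_const _) bound
    (Set.right_mem_Icc.2 hab)

/-- Convergence of the difference quotients at `0` gives the right derivative at `t` of any
function that agrees with `s ↦ L (T (s - t) u)` on `[t, ∞)`. -/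
theorem hasDerivWithinAt_clm_orbit
    {X : Type*} [NormedAddCommGroup X] [NormedSpace ℂ X]
    {Z : Type*} [NormedAddCommGroup Z] [NormedSpace ℂ Z]
    {T : ℝ → X →L[ℂ] X} (hT0 : T 0 = 1) {u v : X}
    (huv : Filter.Tendsto (fun t : ℝ => (t : ℂ)⁻¹ • (T t u - u))
        (nhdsWithin 0 (Set.Ioi 0)) (nhds v))
    (L : X →L[ℂ] Z) {F : ℝ → Z} {t : ℝ} (hF : ∀ s, t ≤ s → F s = L (T (s - t) u)) :
    HasDerivWithinAt F (L v) (Set.Ici t) t := by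
  have h0 : HasDerivWithinAt (fun s => T s u) v (Set.Ici (t - t)) (t - t) := by
    rw [sub_self, ← hasDerivWithinAt_Ioi_iff_Ici, hasDerivWithinAt_iff_tendsto_slope' (by simp)]
    refine huv.congr fun s => ?_
    rw [slope_def_module, sub_zero, hT0, ← Complex.ofReal_inv, Complex.coe_smul]
    rfl
  have h1 : HasDerivWithinAt (fun s => T (s - t) u) v (Set.Ici t) t := by
    have := h0.scomp (h := fun s => s - t) t ((hasDerivWithinAt_id t (Set.Ici t)).sub_const t)
      (fun s hs => Set.mem_Ici.2 (sub_le_sub_right (Set.mem_Ici.1 hs) t))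
    simpa [Function.comp_def] using this
  have h2 : HasDerivWithinAt (fun s => L (T (s - t) u)) (L v) (Set.Ici t) t :=
    (L.restrictScalars ℝ).hasFDerivAt.comp_hasDerivWithinAt t h1
  exact h2.congr (fun s hs => hF s hs) (hF t le_rfl)

theorem hasDerivWithinAt_exp_smul {Z : Type*} [NormedAddCommGroup Z] [NormedSpace ℂ Z]
    {F : ℝ → Z} {v : Z} {s : Set ℝ} {t : ℝ} (lam : ℂ) (hF : HasDerivWithinAt F v s t) :
    HasDerivWithinAt (fun r : ℝ => Complex.exp (-lam * r) • F r)
      (Complex.exp (-lam * t) • (v - lam • F t)) s t := by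
  have h1 : HasDerivAt (fun r : ℝ => Complex.exp (-lam * r)) (Complex.exp (-lam * t) * (-lam)) t := by
    have := ((hasDerivAt_id (t : ℂ)).const_mul (-lam)).cexp.comp_ofReal
    simpa using this
  refine (h1.hasDerivWithinAt.smul hF).congr_deriv ?_
  rw [smul_sub, mul_smul, neg_smul, smul_neg]
  abel

theorem norm_exp_neg_mul_ofReal (lam : ℂ) (t : ℝ) :
    ‖Complex.exp (-lam * t)‖ = Real.exp (-(lam.re * t)) := by
  simp [Complex.norm_exp]

/-- The Hille–Yosida bound: if `A u = lam u - x` in the sense of difference quotients, then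
`‖u‖ ≤ c ‖x‖ / Re lam`. -/
theorem norm_le_of_tendsto_generator
    {X : Type*} [NormedAddCommGroup X] [NormedSpace ℂ X]
    {T : ℝ → X →L[ℂ] X} (hT0 : T 0 = 1)
    (hTsemi : ∀ s t : ℝ, 0 ≤ s → 0 ≤ t → T (s + t) = T s ∘L T t)
    (hTcont : ∀ x : X, ContinuousOn (fun t : ℝ => T t x) (Set.Ici 0))
    {c : ℝ} (hTbdd : ∀ t : ℝ, 0 ≤ t → ‖T t‖ ≤ c) {lam : ℂ} (hlam : 0 < lam.re) {u x : X}
    (hu : Filter.Tendsto (fun t : ℝ => (t : ℂ)⁻¹ • (T t u - u))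
        (nhdsWithin 0 (Set.Ioi 0)) (nhds (lam • u - x))) :
    ‖u‖ ≤ c * ‖x‖ / lam.re := by
  have hc : 0 ≤ c := (norm_nonneg _).trans (hTbdd 0 le_rfl)
  set r := lam.re with hr
  have key : ∀ N : ℝ, 0 ≤ N →
      ‖u‖ ≤ Real.exp (-(r * N)) * (c * ‖u‖) + c * ‖x‖ / r := by
    intro N hN
    have hB : ∀ t : ℝ, HasDerivAt (fun t => -(c * ‖x‖ / r) * Real.exp (-(r * t)))
        (Real.exp (-(r * t)) * (c * ‖x‖)) t := by
      intro t
      have := ((((hasDerivAt_id t).const_mul r).fun_neg).exp).const_mul (-(c * ‖x‖ / r))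
      refine this.congr_deriv ?_
      simp only [id]
      field_simp
    have h := norm_sub_le_of_norm_deriv_right_le
      (F := fun t : ℝ => Complex.exp (-lam * t) • T t u)
      (F' := fun t : ℝ => Complex.exp (-lam * t) • (T t (lam • u - x) - lam • T t u))
      (B := fun t => -(c * ‖x‖ / r) * Real.exp (-(r * t)))
      (B' := fun t => Real.exp (-(r * t)) * (c * ‖x‖)) hN
      ((by fun_prop : Continuous fun t : ℝ => Complex.exp (-lam * t)).continuousOn.smul
        ((hTcont u).mono fun t ht => ht.1))
      (fun t ht => hasDerivWithinAt_exp_smul lam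
        (hasDerivWithinAt_clm_orbit hT0 hu (T t) fun s hs => by
          rw [← ContinuousLinearMap.comp_apply, ← hTsemi t (s - t) ht.1 (by linarith)]
          congr 2; ring))
      (fun t _ => (hB t).continuousAt.continuousWithinAt)
      (fun t _ => (hB t).hasDerivWithinAt)
      (fun t ht => by
        rw [norm_smul, norm_exp_neg_mul_ofReal, map_sub, map_smul, sub_sub_cancel_left, norm_neg]
        gcongr
        exact (T t).le_of_opNorm_le (hTbdd t ht.1) x)
    simp only [hT0, Complex.ofReal_zero, mul_zero, Complex.exp_zero, one_smul, neg_zero,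
      Real.exp_zero, mul_one, one_apply_eq_self] at h
    have h1 : ‖Complex.exp (-lam * N) • T N u‖ ≤ Real.exp (-(r * N)) * (c * ‖u‖) := by
      rw [norm_smul, norm_exp_neg_mul_ofReal]
      gcongr
      exact (T N).le_of_opNorm_le (hTbdd N hN) u
    have h2 := norm_sub_norm_le u (Complex.exp (-lam * N) • T N u)
    rw [norm_sub_rev] at h2
    have h3 : 0 ≤ c * ‖x‖ / r * Real.exp (-(r * N)) := by positivity
    linarith
  have hexp : Filter.Tendsto (fun N : ℝ => Real.exp (-(r * N))) Filter.atTop (nhds 0) :=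
    Real.tendsto_exp_neg_atTop_nhds_zero.comp (Filter.tendsto_id.const_mul_atTop hlam)
  have hlim := (hexp.mul_const (c * ‖u‖)).add_const (c * ‖x‖ / r)
  rw [zero_mul, zero_add] at hlim
  exact ge_of_tendsto hlim (Filter.eventually_atTop.2 ⟨0, key⟩)

/-- If `C : D(A) → Y` is relatively bounded for the generator `A` of a
bounded C₀-semigroup on a Banach space `X`, `C T(t)` extends to a bounded operator
`S(t)` with `‖S(t)‖ ≤ M/t^(1/p)` for all `t > 0` (`1 < p ≤ ∞`, `1/∞ := 0`), then `C`
satisfies the `p`-Weiss condition for `A`. -/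
theorem stmt_4
    {X : Type*} [NormedAddCommGroup X] [NormedSpace ℂ X] [CompleteSpace X]
    {Y : Type*} [NormedAddCommGroup Y] [NormedSpace ℂ Y] [CompleteSpace Y]
    (T : ℝ → X →L[ℂ] X)
    (hT0 : T 0 = 1)
    (hTsemi : ∀ s t : ℝ, 0 ≤ s → 0 ≤ t → T (s + t) = T s ∘L T t)
    (hTcont : ∀ x : X, ContinuousOn (fun t : ℝ => T t x) (Set.Ici 0))
    (hTbdd : ∃ c : ℝ, ∀ t : ℝ, 0 ≤ t → ‖T t‖ ≤ c)
    (Dom : Set X) (A : X → X)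
    (hgen : ∀ x y, (x ∈ Dom ∧ A x = y) ↔
      Filter.Tendsto (fun t : ℝ => (t : ℂ)⁻¹ • (T t x - x))
        (nhdsWithin 0 (Set.Ioi 0)) (nhds y))
    (R : ℂ → X →L[ℂ] X)
    (hR₁ : ∀ lam : ℂ, 0 < lam.re → ∀ x, R lam x ∈ Dom ∧ lam • R lam x - A (R lam x) = x)
    (hR₂ : ∀ lam : ℂ, 0 < lam.re → ∀ x ∈ Dom, R lam (lam • x - A x) = x)
    (C : X → Y)
    (hCadd : ∀ x ∈ Dom, ∀ y ∈ Dom, C (x + y) = C x + C y)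
    (hCsmul : ∀ (a : ℂ), ∀ x ∈ Dom, C (a • x) = a • C x)
    (hCbdd : ∃ c > 0, ∀ x ∈ Dom, ‖C x‖ ≤ c * (‖x‖ + ‖A x‖))
    (S : ℝ → X →L[ℂ] Y)
    (hS : ∀ t : ℝ, 0 < t → ∀ x ∈ Dom, S t x = C (T t x))
    (p : ℝ≥0∞) (hp : 1 < p)
    (M : ℝ) (hM : 0 < M)
    (hSbdd : ∀ t : ℝ, 0 < t → ‖S t‖ ≤ M / t ^ (1 / p.toReal)) :
    ∃ K > 0, ∀ lam : ℂ, 0 < lam.re → ∀ x : X,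
      ‖C (R lam x)‖ ≤ K * ‖x‖ / lam.re ^ (1 - 1 / p.toReal) := by
  obtain ⟨c, hc⟩ := hTbdd
  obtain ⟨d, hd, hCd⟩ := hCbdd
  have hc0 : 0 ≤ c := (norm_nonneg _).trans (hc 0 le_rfl)
  set α : ℝ := 1 / p.toReal with hα
  have hα1 : α < 1 := by
    rcases eq_or_ne p ⊤ with rfl | hp'
    · simp [hα]
    · have : 1 < p.toReal := by
        rw [← ENNReal.toReal_one]
        exact (ENNReal.toReal_lt_toReal ENNReal.one_ne_top hp').2 hp
      rw [hα, div_lt_one (by linarith)]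
      exact this
  have hTA : ∀ u ∈ Dom, ∀ t : ℝ, 0 ≤ t → T t u ∈ Dom ∧ A (T t u) = T t (A u) := by
    intro u hu t ht
    rw [hgen]
    refine (((T t).continuous.tendsto _).comp ((hgen u (A u)).1 ⟨hu, rfl⟩)).congr' ?_
    filter_upwards [self_mem_nhdsWithin] with h hh
    have hh' : (0 : ℝ) ≤ h := le_of_lt hh
    have e : T t (T h u) = T h (T t u) := by
      rw [← ContinuousLinearMap.comp_apply, ← ContinuousLinearMap.comp_apply,
        ← hTsemi t h ht hh', ← hTsemi h t hh' ht, add_comm]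
    simp [e]
  have hAsub : ∀ u ∈ Dom, ∀ v ∈ Dom, u - v ∈ Dom ∧ A (u - v) = A u - A v := by
    intro u hu v hv
    rw [hgen]
    refine (((hgen u _).1 ⟨hu, rfl⟩).sub ((hgen v _).1 ⟨hv, rfl⟩)).congr fun h => ?_
    rw [← smul_sub, map_sub]
    congr 1
    abel
  have hCsub : ∀ u ∈ Dom, ∀ v ∈ Dom, C (u - v) = C u - C v := by
    intro u hu v hv
    have := hCadd (u - v) (hAsub u hu v hv).1 v hv
    rw [sub_add_cancel] at this
    rw [this, add_sub_cancel_right]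
  have hCcont : ∀ u ∈ Dom, ContinuousOn (fun t => C (T t u)) (Set.Ici 0) := by
    intro u hu t ht
    rw [ContinuousWithinAt, tendsto_iff_norm_sub_tendsto_zero]
    have h1 := tendsto_iff_norm_sub_tendsto_zero.1 (hTcont u t ht)
    have h2 := tendsto_iff_norm_sub_tendsto_zero.1 (hTcont (A u) t ht)
    have h3 := (h1.add h2).const_mul d
    rw [add_zero, mul_zero] at h3
    refine squeeze_zero' (Filter.Eventually.of_forall fun _ => norm_nonneg _) ?_ h3
    filter_upwards [self_mem_nhdsWithin] with s hs
    obtain ⟨hs1, hs2⟩ := hTA u hu s hs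
    obtain ⟨ht1, ht2⟩ := hTA u hu t ht
    obtain ⟨hd1, hd2⟩ := hAsub _ hs1 _ ht1
    rw [← hCsub _ hs1 _ ht1, ← hs2, ← ht2, ← hd2]
    exact hCd _ hd1
  refine ⟨M / (1 - α) + M * c + 1, by have : 0 < 1 - α := by linarith
                                      positivity, ?_⟩
  intro lam hlam x
  obtain ⟨hu, hux⟩ := hR₁ lam hlam x
  generalize R lam x = u at hu hux ⊢
  have hAu : A u = lam • u - x := by rw [← hux]; abel
  have hgu := (hgen u _).1 ⟨hu, hAu⟩
  have hnu := norm_le_of_tendsto_generator hT0 hTsemi hTcont hc hlam hgu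
  set r := lam.re with hr
  have hτ : 0 < r⁻¹ := inv_pos.2 hlam
  have hgcont : ContinuousOn (fun t : ℝ => Complex.exp (-lam * t) • C (T t u)) (Set.Ici 0) :=
    (by fun_prop : Continuous fun t : ℝ => Complex.exp (-lam * t)).continuousOn.smul (hCcont u hu)
  have hexp1 : ∀ t : ℝ, 0 ≤ t → ‖Complex.exp (-lam * t)‖ ≤ 1 := by
    intro t ht
    rw [norm_exp_neg_mul_ofReal, Real.exp_le_one_iff]
    have : 0 ≤ lam.re * t := mul_nonneg hlam.le ht
    linarith
  have hSle : ∀ t : ℝ, 0 < t → ∀ z : X,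
      ‖Complex.exp (-lam * t) • S t z‖ ≤ M * t ^ (-α) * ‖z‖ := by
    intro t ht z
    rw [norm_smul]
    have h2 : ‖S t z‖ ≤ M * t ^ (-α) * ‖z‖ := by
      refine (S t).le_of_opNorm_le ?_ z
      rw [Real.rpow_neg ht.le, ← div_eq_mul_inv]
      exact hSbdd t ht
    exact (mul_le_of_le_one_left (norm_nonneg _) (hexp1 t ht.le)).trans h2
  have hB : ∀ t : ℝ, 0 < t → HasDerivAt (fun t => M * ‖x‖ / (1 - α) * t ^ (1 - α))
      (M * t ^ (-α) * ‖x‖) t := by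
    intro t ht
    have h := (Real.hasDerivAt_rpow_const (p := 1 - α) (Or.inl ht.ne')).const_mul
      (M * ‖x‖ / (1 - α))
    refine h.congr_deriv ?_
    have : 1 - α ≠ 0 := by linarith
    rw [show 1 - α - 1 = -α by ring]
    field_simp
  have key : ∀ ε ∈ Set.Ioo 0 r⁻¹,
      ‖Complex.exp (-lam * ε) • C (T ε u)‖ ≤
        M * ‖x‖ / (1 - α) * r⁻¹ ^ (1 - α) + M * r⁻¹ ^ (-α) * ‖u‖ := by
    intro ε hε
    have h := norm_sub_le_of_norm_deriv_right_le
      (F := fun t : ℝ => Complex.exp (-lam * t) • C (T t u))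
      (F' := fun t : ℝ => Complex.exp (-lam * t) • (S t (lam • u - x) - lam • C (T t u)))
      hε.2.le (hgcont.mono fun t ht => hε.1.le.trans ht.1)
      (fun t ht => hasDerivWithinAt_exp_smul lam
        (hasDerivWithinAt_clm_orbit hT0 hgu (S t) fun s hs => by
          have ht0 : 0 < t := hε.1.trans_le ht.1
          have hst : 0 ≤ s - t := by linarith
          rw [hS t ht0 _ (hTA u hu _ hst).1, ← ContinuousLinearMap.comp_apply,
            ← hTsemi t (s - t) ht0.le hst, add_sub_cancel]))
      (fun t ht => (hB t (hε.1.trans_le ht.1)).continuousAt.continuousWithinAt)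
      (fun t ht => (hB t (hε.1.trans_le ht.1)).hasDerivWithinAt)
      (fun t ht => by
        have ht0 : 0 < t := hε.1.trans_le ht.1
        rw [← hS t ht0 u hu, map_sub, map_smul, sub_sub_cancel_left, smul_neg, norm_neg]
        exact hSle t ht0 x)
    have h1 := hSle r⁻¹ hτ u
    rw [hS _ hτ u hu] at h1
    have h2 := norm_sub_norm_le (Complex.exp (-lam * ε) • C (T ε u))
      (Complex.exp (-lam * (r⁻¹ : ℝ)) • C (T r⁻¹ u))
    rw [norm_sub_rev] at h2
    have h3 : 0 ≤ M * ‖x‖ / (1 - α) * ε ^ (1 - α) := by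
      have : 0 < 1 - α := by linarith
      have := hε.1
      positivity
    linarith
  have hlim : Filter.Tendsto (fun t : ℝ => ‖Complex.exp (-lam * t) • C (T t u)‖)
      (nhdsWithin 0 (Set.Ioi 0)) (nhds ‖C u‖) := by
    have := ((hgcont 0 Set.self_mem_Ici).mono Set.Ioi_subset_Ici_self).norm
    simpa [ContinuousWithinAt, hT0] using this
  have hfin := le_of_tendsto hlim
    (Filter.mem_of_superset (Ioo_mem_nhdsGT hτ) key)
  have hpow : r⁻¹ ^ (-α) = r⁻¹ ^ (1 - α) * r := by
    rw [show -α = (1 - α) - 1 by ring, Real.rpow_sub_one hτ.ne', div_inv_eq_mul]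
  have hpow' : (r ^ (1 - α))⁻¹ = r⁻¹ ^ (1 - α) := (Real.inv_rpow hlam.le _).symm
  rw [div_eq_mul_inv, hpow']
  rw [hpow] at hfin
  set P := r⁻¹ ^ (1 - α)
  have hP : 0 < P := Real.rpow_pos_of_pos hτ _
  calc ‖C u‖ ≤ M * ‖x‖ / (1 - α) * P + M * (P * r) * ‖u‖ := hfin
    _ ≤ M * ‖x‖ / (1 - α) * P + M * (P * r) * (c * ‖x‖ / r) := by gcongr
    _ = (M / (1 - α) + M * c) * ‖x‖ * P := by field_simp
    _ ≤ (M / (1 - α) + M * c + 1) * ‖x‖ * P := by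
      gcongr ?_ * ‖x‖ * P
      exact le_add_of_nonneg_right zero_le_one
end
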